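/- arXiv:2104.03950 — 2 statements merged into one kernel-verified Lean document; each statement's English description precedes it below -/
import Mathlib

section
/- Let K >= 5 be an odd integer, set a = 2K-3, c = 4K^2-16K+11, d = 2K-5, m = ceil(K^2 - (7/2)K + 2), and let Delta_K be the triangle with vertices (0,0), (m-K+2, 0), ((K-1)/2 + 1/c)*(d,a). Then there exists a nonzero irreducible polynomial f ∈ C[x,y] that is supported in Delta_K and vanishes to order at least m at e = (1,1). -/
namespace NegativeCurve

section Univariate

open Polynomial

/-- A polynomial of degree at most `M` divisible by `X ^ r * (X - 1) ^ (M - r)` is a scalar multiple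
of it, which determines its second coefficient in terms of the first. -/
theorem coeff_pred_of_dvd {P : ℂ[X]} {M r : ℕ} (hM : 1 ≤ M) (hr : r ≤ M) (hdeg : P.natDegree ≤ M)
    (h₁ : X ^ r ∣ P) (h₂ : (X - 1) ^ (M - r) ∣ P) :
    P.coeff (M - 1) = -((M : ℂ) - r) * P.coeff M := by
  have hcop : IsCoprime (X ^ r : ℂ[X]) ((X - 1) ^ (M - r)) :=
    IsCoprime.pow ⟨1, -1, by ring⟩
  obtain ⟨Q, rfl⟩ := hcop.mul_dvd h₁ h₂
  have hX : (X ^ r : ℂ[X]).Monic := monic_X_pow r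
  have hX1 : (X - 1 : ℂ[X]).Monic := by simpa using monic_X_sub_C (1 : ℂ)
  have hmon : (X ^ r * (X - 1) ^ (M - r) : ℂ[X]).Monic := hX.mul (hX1.pow _)
  have hd1 : (X - 1 : ℂ[X]).natDegree = 1 := by simpa using natDegree_X_sub_C (1 : ℂ)
  have hnd : (X ^ r * (X - 1) ^ (M - r) : ℂ[X]).natDegree = M := by
    rw [hX.natDegree_mul (hX1.pow _), hX1.natDegree_pow, hd1, natDegree_X_pow]
    omega
  by_cases hQ : Q = 0
  · simp [hQ]
  have hQ0 : Q.natDegree = 0 := by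
    rw [hmon.natDegree_mul' hQ, hnd] at hdeg
    omega
  obtain ⟨c, rfl⟩ := natDegree_eq_zero.mp hQ0
  have hnext : (X ^ r * (X - 1) ^ (M - r) : ℂ[X]).coeff (M - 1) = -((M : ℂ) - r) := by
    have h := nextCoeff_of_natDegree_pos (p := (X ^ r * (X - 1) ^ (M - r) : ℂ[X])) (by omega)
    rw [hnd] at h
    rw [← h, hX.nextCoeff_mul (hX1.pow _), hX1.nextCoeff_pow, Monic.nextCoeff_pow monic_X]
    have h1 : (X - 1 : ℂ[X]).nextCoeff = -1 := by simpa using nextCoeff_X_sub_C (1 : ℂ)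
    have h0 : (X : ℂ[X]).nextCoeff = 0 := by simpa using nextCoeff_X_sub_C (0 : ℂ)
    rw [h1, h0]
    simp [Nat.cast_sub hr]
  have htop : (X ^ r * (X - 1) ^ (M - r) : ℂ[X]).coeff M = 1 := by
    simpa [hnd] using hmon.coeff_natDegree
  rw [coeff_mul_C, coeff_mul_C, hnext, htop, one_mul]

theorem X_sub_one_pow_dvd_iff {P : ℂ[X]} {n : ℕ} :
    (X - 1) ^ n ∣ P ↔ ∀ r < n, (taylor 1 P).coeff r = 0 := by
  have h := X_sub_C_pow_dvd_iff (p := P) (t := 1) (n := n)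
  rw [map_one] at h
  rw [h, X_pow_dvd_iff, taylor_apply, map_one]

/-- Multiplying the `i`-th coefficient of `(1 - X) ^ m` by `b i`, with `b` a polynomial of degree
at most `r`, lowers the order of vanishing at `1` by at most `r`. -/
theorem X_sub_one_pow_dvd_sum (m : ℕ) {r : ℕ} {b : ℂ[X]} (hb : b.natDegree ≤ r) :
    (X - 1) ^ (m - r) ∣ ∑ i ∈ Finset.range (m + 1),
      monomial i ((-1) ^ i * (m.choose i : ℂ) * b.eval (i : ℂ)) := by
  have key : ∀ s : ℕ, (X - 1) ^ (m - s) ∣ ∑ i ∈ Finset.range (m + 1),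
      monomial i ((-1) ^ i * (m.choose i : ℂ) * (i : ℂ) ^ s) := by
    intro s
    induction s with
    | zero =>
      have : (∑ i ∈ Finset.range (m + 1),
          monomial i ((-1) ^ i * (m.choose i : ℂ) * (i : ℂ) ^ 0) : ℂ[X]) = (1 - X) ^ m := by
        rw [sub_eq_neg_add, add_pow]
        refine Finset.sum_congr rfl fun i _ => ?_
        rw [← C_mul_X_pow_eq_monomial]
        simp only [pow_zero, mul_one, one_pow, map_mul, map_pow, map_neg, map_one, map_natCast]
        rw [neg_pow (X : ℂ[X]) i]
        ring
      rw [this, ← neg_sub X, neg_pow]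
      exact Dvd.intro_left _ rfl
    | succ s ih =>
      obtain ⟨Q, hQ⟩ := ih
      have hder : (∑ i ∈ Finset.range (m + 1),
          monomial i ((-1) ^ i * (m.choose i : ℂ) * (i : ℂ) ^ (s + 1)) : ℂ[X]) =
          X * derivative (∑ i ∈ Finset.range (m + 1),
            monomial i ((-1) ^ i * (m.choose i : ℂ) * (i : ℂ) ^ s)) := by
        rw [derivative_sum, Finset.mul_sum]
        refine Finset.sum_congr rfl fun i _ => ?_
        rcases i with _ | i
        · simp
        · rw [derivative_monomial, X_mul_monomial]
          simp only [Nat.add_sub_cancel]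
          congr 1
          ring
      rw [hder, hQ]
      refine Dvd.dvd.mul_left ?_ X
      rw [derivative_mul]
      refine dvd_add (Dvd.dvd.mul_right ?_ _) (Dvd.dvd.mul_right (pow_dvd_pow _ (by omega)) _)
      rw [derivative_pow]
      refine Dvd.dvd.mul_right (Dvd.dvd.mul_left (pow_dvd_pow _ (by omega)) _) _
  have hexp : (∑ i ∈ Finset.range (m + 1),
      monomial i ((-1) ^ i * (m.choose i : ℂ) * b.eval (i : ℂ)) : ℂ[X]) =
      ∑ s ∈ Finset.range (r + 1), C (b.coeff s) * ∑ i ∈ Finset.range (m + 1),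
        monomial i ((-1) ^ i * (m.choose i : ℂ) * (i : ℂ) ^ s) := by
    simp_rw [Finset.mul_sum]
    rw [Finset.sum_comm]
    refine Finset.sum_congr rfl fun i _ => ?_
    rw [eval_eq_sum_range' (Nat.lt_succ_of_le hb), Finset.mul_sum, map_sum]
    refine Finset.sum_congr rfl fun s _ => ?_
    rw [C_mul_monomial]
    congr 1
    ring
  rw [hexp]
  refine Finset.dvd_sum fun s hs => Dvd.dvd.mul_left ?_ _
  exact (pow_dvd_pow _ (by have := Finset.mem_range.mp hs; omega)).trans (key s)

/-- Polynomials `Y ^ lo i * Q i` with `deg Q i < n i` whose Taylor coefficients of order `r` at `1`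
depend polynomially on `i`, with degree at most `r`, provided that at most `r + 1` of the `n i` are
at most `r`. -/
theorem exists_interpolating_columns (m : ℕ) (lo n : ℕ → ℕ) (hn : ∀ i ≤ m, 1 ≤ n i)
    (hcard : ∀ r, ((Finset.range (m + 1)).filter fun i => n i ≤ r).card ≤ r + 1) (R : ℕ) :
    ∃ (P : ℕ → ℂ[X]) (b : ℕ → ℂ[X]), b 0 = 1 ∧ (∀ r, (b r).natDegree ≤ r) ∧
      (∀ i ≤ m, ∀ j, (P i).coeff j ≠ 0 → lo i ≤ j ∧ j < lo i + n i) ∧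
      ∀ i ≤ m, ∀ r < R, (taylor 1 (P i)).coeff r = (b r).eval (i : ℂ) := by
  classical
  induction R with
  | zero => exact ⟨0, fun _ => 1, rfl, by simp, by simp, by simp⟩
  | succ R ih =>
    obtain ⟨P, b, hb0, hbdeg, hP, hPb⟩ := ih
    set S := (Finset.range (m + 1)).filter fun i => n i ≤ R with hS
    obtain ⟨c, hc0, hcdeg, hc⟩ : ∃ c : ℂ[X], (R = 0 → c = 1) ∧ c.natDegree ≤ R ∧
        ∀ i ∈ S, c.eval (i : ℂ) = (taylor 1 (P i)).coeff R := by
      rcases Nat.eq_zero_or_pos R with rfl | hR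
      · refine ⟨1, fun _ => rfl, by simp, fun i hi => ?_⟩
        rw [hS, Finset.mem_filter, Finset.mem_range] at hi
        have := hn i (by omega)
        omega
      · have hinj : Set.InjOn (fun i : ℕ => (i : ℂ)) S := Nat.cast_injective.injOn
        refine ⟨Lagrange.interpolate S (fun i : ℕ => (i : ℂ)) fun i => (taylor 1 (P i)).coeff R,
          by omega, ?_, fun i hi => Lagrange.eval_interpolate_at_node _ hinj hi⟩
        have h1 := Lagrange.degree_interpolate_lt (fun i => (taylor 1 (P i)).coeff R) hinj
        have h2 : (Lagrange.interpolate S (fun i : ℕ => (i : ℂ))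
            fun i => (taylor 1 (P i)).coeff R).degree < ((R + 1 : ℕ) : WithBot ℕ) :=
          lt_of_lt_of_le h1 (by exact_mod_cast hcard R)
        exact natDegree_le_iff_coeff_eq_zero.mpr fun N hN =>
          coeff_eq_zero_of_degree_lt (h2.trans_le (by exact_mod_cast hN))
    refine ⟨fun i => P i + if n i ≤ R then 0 else
      C (c.eval (i : ℂ) - (taylor 1 (P i)).coeff R) * (X ^ lo i * (X - 1) ^ R),
      Function.update b R c, ?_, ?_, ?_, ?_⟩
    · rcases Nat.eq_zero_or_pos R with rfl | hR
      · simp [hc0]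
      · rw [Function.update_of_ne (by omega), hb0]
    · intro r
      rcases eq_or_ne r R with rfl | hr
      · simpa using hcdeg
      · simpa [hr] using hbdeg r
    · intro i hi j hj
      by_cases hPj : (P i).coeff j = 0
      · by_cases hni : n i ≤ R
        · simp [hni, hPj] at hj
        · simp only [hni, if_false, coeff_add, hPj, zero_add, coeff_C_mul] at hj
          have hj' := right_ne_zero_of_mul hj
          rw [coeff_X_pow_mul'] at hj'
          split_ifs at hj' with hlo
          · have hle := le_natDegree_of_ne_zero hj'
            have hd : ((X - 1 : ℂ[X]) ^ R).natDegree ≤ R := by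
              simpa using natDegree_pow_le_of_le R (natDegree_X_sub_C_le (1 : ℂ))
            omega
          · exact absurd rfl hj'
      · exact hP i hi j hPj
    · intro i hi r hr
      have hshift : taylor 1 (X ^ lo i * (X - 1) ^ R : ℂ[X]) = (X + 1) ^ lo i * X ^ R := by
        simp [taylor_apply]
      by_cases hni : n i ≤ R
      · have hiS : i ∈ S := by simp [hS, hni]; omega
        rcases eq_or_ne r R with rfl | hrR
        · simp [hni, hc i hiS]
        · simpa [hni, hrR] using hPb i hi r (by omega)
      · dsimp only
        rw [if_neg hni, map_add, coeff_add, taylor_mul _ (C _), taylor_C, hshift, coeff_C_mul,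
          coeff_mul_X_pow']
        rcases eq_or_ne r R with rfl | hrR
        · simp [coeff_zero_eq_eval_zero]
        · rw [if_neg (by omega), Function.update_of_ne hrR, hPb i hi r (by omega)]
          simp

end Univariate

section Bivariate

open MvPolynomial

/-- A nonzero coefficient of `x ^ i * P(y)` sits in column `i`, at a nonzero coefficient of `P`. -/
theorem coeff_X_pow_mul_aeval_ne_zero {i : ℕ} {P : Polynomial ℂ} {e : Fin 2 →₀ ℕ}
    (he : coeff e (X 0 ^ i * Polynomial.aeval (X 1) P : MvPolynomial (Fin 2) ℂ) ≠ 0) :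
    e 0 = i ∧ P.coeff (e 1) ≠ 0 := by
  have hmon : ∀ j, (X 0 ^ i * P.coeff j • X 1 ^ j : MvPolynomial (Fin 2) ℂ) =
      monomial (Finsupp.single 0 i + Finsupp.single 1 j) (P.coeff j) := by
    intro j
    rw [X_pow_eq_monomial, X_pow_eq_monomial, smul_monomial, monomial_mul]
    simp
  rw [Polynomial.aeval_eq_sum_range, Finset.mul_sum, coeff_sum] at he
  obtain ⟨j, -, hj⟩ := Finset.exists_ne_zero_of_sum_ne_zero he
  rw [hmon, coeff_monomial] at hj
  split_ifs at hj with h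
  · subst h
    simpa using hj
  · exact absurd rfl hj

/-- If the columns of a set of lattice points satisfy the counting condition of
`exists_interpolating_columns`, then some polynomial supported there vanishes to order `m` at
`(1, 1)` and restricts to `(1 - x) ^ m` on `y = 1`. -/
theorem exists_supported_vanishing (m : ℕ) (lo n : ℕ → ℕ) (hn : ∀ i ≤ m, 1 ≤ n i)
    (hcard : ∀ r, ((Finset.range (m + 1)).filter fun i => n i ≤ r).card ≤ r + 1) (hm : 1 ≤ m) :
    ∃ f : MvPolynomial (Fin 2) ℂ,
      (∀ e ∈ f.support, e 0 ≤ m ∧ lo (e 0) ≤ e 1 ∧ e 1 < lo (e 0) + n (e 0)) ∧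
      aeval ![(Polynomial.X : Polynomial ℂ), 1] f = (1 - Polynomial.X) ^ m ∧
      f ∈ (Ideal.span {X 0 - 1, X 1 - 1} : Ideal (MvPolynomial (Fin 2) ℂ)) ^ m := by
  obtain ⟨P, b, hb0, hbdeg, hP, hPb⟩ := exists_interpolating_columns m lo n hn hcard m
  refine ⟨∑ i ∈ Finset.range (m + 1), C ((-1) ^ i * (m.choose i : ℂ)) *
    (X 0 ^ i * Polynomial.aeval (X 1) (P i)), ?_, ?_, ?_⟩
  · intro e he
    rw [mem_support_iff, coeff_sum] at he
    obtain ⟨i, hi, hne⟩ := Finset.exists_ne_zero_of_sum_ne_zero he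
    rw [coeff_C_mul] at hne
    obtain ⟨rfl, h⟩ := coeff_X_pow_mul_aeval_ne_zero (right_ne_zero_of_mul hne)
    have hle : e 0 ≤ m := Nat.lt_succ_iff.mp (Finset.mem_range.mp hi)
    exact ⟨hle, hP _ hle _ h⟩
  · have h1 : ∀ i ≤ m, (P i).eval 1 = 1 := by
      intro i hi
      have h := hPb i hi 0 (by omega)
      rwa [Polynomial.taylor_coeff_zero, hb0, Polynomial.eval_one] at h
    rw [map_sum, sub_eq_neg_add, add_pow]
    refine Finset.sum_congr rfl fun i hi => ?_
    have hPi : Polynomial.aeval (1 : Polynomial ℂ) (P i) = 1 := by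
      have h := Polynomial.aeval_algebraMap_apply (Polynomial ℂ) (1 : ℂ) (P i)
      rw [map_one] at h
      rw [h, Polynomial.coe_aeval_eq_eval, h1 i (Nat.lt_succ_iff.mp (Finset.mem_range.mp hi)),
        map_one]
    rw [map_mul, map_mul (aeval _) (X 0 ^ i), map_pow (aeval _), aeval_X,
      ← Polynomial.aeval_algHom_apply, aeval_X, algHom_C]
    simp only [Matrix.cons_val_zero, Matrix.cons_val_one, hPi, Polynomial.algebraMap_eq]
    rw [neg_pow (Polynomial.X : Polynomial ℂ) i]
    simp
    ring
  · set I : Ideal (MvPolynomial (Fin 2) ℂ) := Ideal.span {X 0 - 1, X 1 - 1} with hI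
    have hx : (X 0 - 1 : MvPolynomial (Fin 2) ℂ) ∈ I := Ideal.subset_span (by simp)
    have hy : (X 1 - 1 : MvPolynomial (Fin 2) ℂ) ∈ I := Ideal.subset_span (by simp)
    obtain ⟨N, hN⟩ : ∃ N, ∀ i ≤ m, (P i).natDegree < N :=
      ⟨(Finset.range (m + 1)).sup (fun i => (P i).natDegree) + 1, fun i hi => Nat.lt_succ_of_le
        (Finset.le_sup (f := fun i => (P i).natDegree) (Finset.mem_range.mpr (by omega)))⟩
    have htaylor : ∀ i ≤ m, Polynomial.aeval (X 1 : MvPolynomial (Fin 2) ℂ) (P i) =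
        ∑ r ∈ Finset.range N, C ((Polynomial.taylor 1 (P i)).coeff r) * (X 1 - 1) ^ r := by
      intro i hi
      conv_lhs => rw [← Polynomial.sum_taylor_eq (P i) 1]
      rw [Polynomial.sum_over_range' _ (by simp) N
        (by rw [Polynomial.natDegree_taylor]; exact hN i hi), map_sum]
      exact Finset.sum_congr rfl fun r _ => by simp [algebraMap_eq]
    have hsum : (∑ i ∈ Finset.range (m + 1), C ((-1) ^ i * (m.choose i : ℂ)) *
        (X 0 ^ i * Polynomial.aeval (X 1) (P i)) : MvPolynomial (Fin 2) ℂ) =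
        ∑ r ∈ Finset.range N, (X 1 - 1) ^ r * Polynomial.aeval (X 0 : MvPolynomial (Fin 2) ℂ)
          (∑ i ∈ Finset.range (m + 1), Polynomial.monomial i
            ((-1) ^ i * (m.choose i : ℂ) * (Polynomial.taylor 1 (P i)).coeff r)) := by
      simp_rw [map_sum, Finset.mul_sum]
      rw [Finset.sum_comm]
      refine Finset.sum_congr rfl fun i hi => ?_
      rw [htaylor i (Nat.lt_succ_iff.mp (Finset.mem_range.mp hi)), Finset.mul_sum, Finset.mul_sum]
      refine Finset.sum_congr rfl fun r _ => ?_
      rw [Polynomial.aeval_monomial, algebraMap_eq, map_mul C (_ * _)]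
      ring
    rw [hsum]
    refine Ideal.sum_mem _ fun r _ => ?_
    rcases lt_or_ge r m with hr | hr
    · have hdvd := X_sub_one_pow_dvd_sum m (hbdeg r)
      have heq : (∑ i ∈ Finset.range (m + 1), Polynomial.monomial i
          ((-1) ^ i * (m.choose i : ℂ) * (Polynomial.taylor 1 (P i)).coeff r)) =
          ∑ i ∈ Finset.range (m + 1), Polynomial.monomial i
            ((-1) ^ i * (m.choose i : ℂ) * (b r).eval (i : ℂ)) :=
        Finset.sum_congr rfl fun i hi => by
          rw [hPb i (Nat.lt_succ_iff.mp (Finset.mem_range.mp hi)) r hr]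
      obtain ⟨Q, hQ⟩ := hdvd
      rw [heq, hQ, map_mul, ← mul_assoc]
      refine Ideal.mul_mem_right _ _ ?_
      have : m = r + (m - r) := by omega
      rw [this, pow_add, ← this]
      refine Ideal.mul_mem_mul (Ideal.pow_mem_pow hy r) ?_
      simpa using Ideal.pow_mem_pow hx (m - r)
    · exact Ideal.mul_mem_right _ _ (Ideal.pow_le_pow_right hr (Ideal.pow_mem_pow hy r))

/-- The maximum of a linear functional over the support is additive in products: it is attained on
`g * h` at a sum of points where it is attained on `g` and on `h`. -/
theorem exists_add_mem_support_mul {g h : MvPolynomial (Fin 2) ℂ} (hg : g ≠ 0) (hh : h ≠ 0)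
    (L : (Fin 2 →₀ ℕ) →+ ℤ) :
    ∃ u ∈ g.support, ∃ v ∈ h.support, u + v ∈ (g * h).support ∧
      (∀ e ∈ g.support, L e ≤ L u) ∧ ∀ e ∈ h.support, L e ≤ L v := by
  classical
  obtain ⟨u₀, hu₀, hu₀max⟩ := g.support.exists_max_image L (by simpa using hg)
  obtain ⟨v₀, hv₀, hv₀max⟩ := h.support.exists_max_image L (by simpa using hh)
  obtain ⟨u, hu, v, hv, huniq⟩ := UniqueSums.uniqueAdd_of_nonempty
    (A := g.support.filter fun e => L e = L u₀) (B := h.support.filter fun e => L e = L v₀)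
    ⟨u₀, by simpa using hu₀⟩ ⟨v₀, by simpa using hv₀⟩
  rw [Finset.mem_filter] at hu hv
  refine ⟨u, hu.1, v, hv.1, ?_, fun e he => hu.2 ▸ hu₀max e he, fun e he => hv.2 ▸ hv₀max e he⟩
  rw [mem_support_iff, coeff_mul, Finset.sum_eq_single (u, v)]
  · exact mul_ne_zero (mem_support_iff.mp hu.1) (mem_support_iff.mp hv.1)
  · rintro ⟨s, t⟩ hst hne
    by_contra hcon
    have hs : s ∈ g.support := mem_support_iff.mpr (left_ne_zero_of_mul hcon)
    have ht : t ∈ h.support := mem_support_iff.mpr (right_ne_zero_of_mul hcon)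
    have hadd : s + t = u + v := Finset.HasAntidiagonal.mem_antidiagonal.mp hst
    have hL : L s + L t = L u₀ + L v₀ := by rw [← map_add, hadd, map_add, hu.2, hv.2]
    have hs' := hu₀max s hs
    have ht' := hv₀max t ht
    obtain ⟨rfl, rfl⟩ := huniq (Finset.mem_filter.mpr ⟨hs, by omega⟩)
      (Finset.mem_filter.mpr ⟨ht, by omega⟩) hadd
    exact hne rfl
  · intro hmem
    have : (u, v) ∈ Finset.HasAntidiagonal.antidiagonal (u + v) := by
      rw [Finset.HasAntidiagonal.mem_antidiagonal]
    exact absurd this hmem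

/-- The integral linear functional `e ↦ α * e 0 + β * e 1` on exponents. -/
def expFunctional (α β : ℤ) : (Fin 2 →₀ ℕ) →+ ℤ where
  toFun e := α * e 0 + β * e 1
  map_zero' := by simp
  map_add' e e' := by simp; ring

@[simp] theorem expFunctional_apply (α β : ℤ) (e : Fin 2 →₀ ℕ) :
    expFunctional α β e = α * e 0 + β * e 1 := rfl

/-- The coefficient of `(y - 1) ^ r` in `g`, as a polynomial in `x`. -/
noncomputable def jet (g : MvPolynomial (Fin 2) ℂ) (r : ℕ) : Polynomial ℂ :=
  ∑ e ∈ g.support, Polynomial.monomial (e 0) (coeff e g * ((e 1).choose r : ℂ))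

theorem coeff_jet (g : MvPolynomial (Fin 2) ℂ) (r i : ℕ) :
    (jet g r).coeff i =
      ∑ e ∈ g.support with e 0 = i, coeff e g * ((e 1).choose r : ℂ) := by
  simp [jet, Polynomial.coeff_monomial, Finset.sum_filter]

theorem jet_zero (g : MvPolynomial (Fin 2) ℂ) :
    jet g 0 = aeval ![(Polynomial.X : Polynomial ℂ), 1] g := by
  simp [jet, aeval_def, eval₂_eq', ← Polynomial.C_mul_X_pow_eq_monomial]

/-- The chart `x = 1 + t`, `y = 1 + t * v` of the blowup at `(1, 1)`. -/
noncomputable def blowupChart : MvPolynomial (Fin 2) ℂ →ₐ[ℂ] Polynomial (Polynomial ℂ) :=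
  aeval ![Polynomial.C (Polynomial.X + 1), Polynomial.C Polynomial.X * Polynomial.X + 1]

theorem coeff_blowupChart (g : MvPolynomial (Fin 2) ℂ) (r : ℕ) :
    (blowupChart g).coeff r = Polynomial.X ^ r * (jet g r).comp (Polynomial.X + 1) := by
  have hpow : ∀ j : ℕ, ((Polynomial.C Polynomial.X * Polynomial.X + 1 :
      Polynomial (Polynomial ℂ)) ^ j).coeff r = Polynomial.X ^ r * (j.choose r : Polynomial ℂ) := by
    intro j
    have h : (Polynomial.C Polynomial.X * Polynomial.X + 1 : Polynomial (Polynomial ℂ)) ^ j =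
        ((Polynomial.X + 1) ^ j).comp (Polynomial.C Polynomial.X * Polynomial.X) := by simp
    rw [h, Polynomial.comp_C_mul_X_coeff, Polynomial.coeff_X_add_one_pow]
    ring
  rw [blowupChart, aeval_def, eval₂_eq', Polynomial.finsetSum_coeff, jet,
    ← Polynomial.coe_compRingHom_apply, map_sum, Finset.mul_sum]
  refine Finset.sum_congr rfl fun e _ => ?_
  rw [Polynomial.coe_compRingHom_apply]
  simp only [Fin.prod_univ_two, Matrix.cons_val_zero, Matrix.cons_val_one, ← map_pow]
  rw [← mul_assoc, IsScalarTower.algebraMap_apply ℂ (Polynomial ℂ) (Polynomial (Polynomial ℂ)),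
    Polynomial.algebraMap_eq, Polynomial.algebraMap_eq, ← Polynomial.C_mul,
    Polynomial.coeff_C_mul, hpow, ← Polynomial.C_mul_X_pow_eq_monomial]
  simp
  ring

theorem dvd_jet_of_dvd_blowupChart {g : MvPolynomial (Fin 2) ℂ} {M : ℕ}
    (h : Polynomial.C Polynomial.X ^ M ∣ blowupChart g) (r : ℕ) :
    (Polynomial.X - 1) ^ (M - r) ∣ jet g r := by
  rw [← Polynomial.C_pow, Polynomial.C_dvd_iff_dvd_coeff] at h
  have hr := h r
  rw [coeff_blowupChart] at hr
  have := Polynomial.X_sub_C_pow_dvd_iff (p := jet g r) (t := 1) (n := M - r)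
  rw [map_one] at this
  rw [this]
  rcases le_total M r with hMr | hMr
  · simp [Nat.sub_eq_zero_of_le hMr]
  · rw [← Nat.add_sub_cancel' hMr, pow_add] at hr
    exact (mul_dvd_mul_iff_left (pow_ne_zero _ Polynomial.X_ne_zero)).mp hr

theorem dvd_blowupChart_of_mem {f : MvPolynomial (Fin 2) ℂ} {m : ℕ}
    (hf : f ∈ (Ideal.span {X 0 - 1, X 1 - 1} : Ideal (MvPolynomial (Fin 2) ℂ)) ^ m) :
    Polynomial.C Polynomial.X ^ m ∣ blowupChart f := by
  have hle : (Ideal.span {X 0 - 1, X 1 - 1} : Ideal (MvPolynomial (Fin 2) ℂ)).map blowupChart ≤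
      Ideal.span {Polynomial.C Polynomial.X} := by
    rw [Ideal.map_span, Ideal.span_le]
    rintro _ ⟨p, hp, rfl⟩
    rw [SetLike.mem_coe, Ideal.mem_span_singleton]
    rcases hp with rfl | rfl
    · simp [blowupChart]
    · simp [blowupChart]
  have h := Ideal.pow_right_mono hle m (Ideal.map_pow blowupChart _ m ▸ Ideal.mem_map_of_mem _ hf)
  rwa [Ideal.span_singleton_pow, Ideal.mem_span_singleton] at h

/-- The order of vanishing at `(1, 1)` of a product splits among the factors. -/
theorem exists_split_multiplicity {g h : MvPolynomial (Fin 2) ℂ} {m : ℕ}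
    (hchart : Polynomial.C Polynomial.X ^ m ∣ blowupChart (g * h)) :
    ∃ m₁ m₂ : ℕ, m₁ + m₂ = m ∧
      Polynomial.C Polynomial.X ^ m₁ ∣ blowupChart g ∧
      Polynomial.C Polynomial.X ^ m₂ ∣ blowupChart h := by
  obtain ⟨A, hA⟩ := hchart
  rw [map_mul, mul_comm _ A] at hA
  obtain ⟨i, j, b, c, hij, -, hb, hc⟩ := mul_eq_mul_prime_pow
    (Polynomial.prime_C_iff.mpr Polynomial.prime_X) hA
  exact ⟨i, j, hij, Dvd.intro_left _ hb.symm, Dvd.intro_left _ hc.symm⟩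

/-- No polynomial supported in the triangle with vertices `(0, 0)`, `(k c / (2 K - 1), 0)` and
`k (d, a)`, where `K = 2 s + 5`, and involving the last column vanishes to order `k d` at `(1, 1)`. -/
theorem no_vanishing_in_small_triangle {s k : ℕ} (hk : 1 ≤ k) {g : MvPolynomial (Fin 2) ℂ}
    (hleft : ∀ e ∈ g.support, (4 * s + 5) * e 1 ≤ (4 * s + 7) * e 0)
    (hright : ∀ e ∈ g.support,
      (4 * s + 9) * e 0 ≤ 2 * e 1 + k * (16 * s ^ 2 + 48 * s + 31))
    (hwidth : ∀ e ∈ g.support, e 0 ≤ k * (4 * s + 5))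
    (hchart : Polynomial.C Polynomial.X ^ (k * (4 * s + 5)) ∣ blowupChart g)
    {u : Fin 2 →₀ ℕ} (hu : u ∈ g.support) (hu0 : u 0 = k * (4 * s + 5)) : False := by
  obtain ⟨M, hM⟩ : ∃ M, M = k * (4 * s + 5) := ⟨_, rfl⟩
  obtain ⟨T, hT⟩ : ∃ T, T = k * (4 * s + 7) := ⟨_, rfl⟩
  rw [← hM] at hwidth hchart hu0
  have hMs : 4 * s + 5 ≤ M := by nlinarith
  have hTM : T = M + 2 * k := by rw [hT, hM]; ring
  have hlast : ∀ e ∈ g.support, e 0 = M → e 1 = T := by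
    intro e he heM
    have h1 := hleft e he
    have h2 := hright e he
    rw [heM, hM] at h1 h2
    apply le_antisymm
    · refine Nat.le_of_mul_le_mul_left (h1.trans (le_of_eq ?_)) (show 0 < 4 * s + 5 by omega)
      rw [hT]; ring
    · rw [hT]; nlinarith
  have hprev : ∀ e ∈ g.support, e 0 = M - 1 → e 1 + 2 ≤ T ∧ T ≤ e 1 + (2 * s + 4) := by
    intro e he heM
    have h1 := hleft e he
    have h2 := hright e he
    have heM' : e 0 + 1 = k * (4 * s + 5) := by omega
    constructor
    · have : (4 * s + 5) * (e 1 + 1) < (4 * s + 5) * T := by rw [hT]; nlinarith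
      have := lt_of_mul_lt_mul_left this (Nat.zero_le _)
      omega
    · have : 2 * T ≤ 2 * e 1 + (4 * s + 9) := by rw [hT]; nlinarith
      omega
  have hinit : ∀ e ∈ g.support, e 0 < 2 * s + 3 → e 1 ≤ e 0 := by
    intro e he hlt
    have h1 := hleft e he
    by_contra hcon
    push Not at hcon
    nlinarith
  set γ := coeff u g with hγ
  have hγ0 : γ ≠ 0 := mem_support_iff.mp hu
  have hfilter : g.support.filter (fun e => e 0 = M) = {u} := by
    ext e
    rw [Finset.mem_filter, Finset.mem_singleton]
    constructor
    · rintro ⟨he, heM⟩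
      ext i
      fin_cases i
      · exact heM.trans hu0.symm
      · exact (hlast e he heM).trans (hlast u hu hu0).symm
    · rintro rfl
      exact ⟨hu, hu0⟩
  have hjet : ∀ r < 2 * s + 4, (jet g r).coeff (M - 1) = -((M : ℂ) - r) * (γ * (T.choose r : ℂ)) := by
    intro r hr
    have htop : (jet g r).coeff M = γ * (T.choose r : ℂ) := by
      rw [coeff_jet, hfilter, Finset.sum_singleton, hlast u hu hu0]
    rw [← htop]
    refine coeff_pred_of_dvd (by omega) (by omega) ?_ ?_ (dvd_jet_of_dvd_blowupChart hchart r)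
    · refine Polynomial.natDegree_le_iff_coeff_eq_zero.mpr fun i hi => ?_
      rw [coeff_jet]
      refine Finset.sum_eq_zero fun e he => ?_
      obtain ⟨he', rfl⟩ := Finset.mem_filter.mp he
      exact absurd (hwidth e he') (by omega)
    · refine Polynomial.X_pow_dvd_iff.mpr fun i hi => ?_
      rw [coeff_jet]
      refine Finset.sum_eq_zero fun e he => ?_
      obtain ⟨he', rfl⟩ := Finset.mem_filter.mp he
      rw [Nat.choose_eq_zero_of_lt ((hinit e he' (by omega)).trans_lt hi)]
      simp
  set B : Polynomial ℂ := ∑ e ∈ g.support with e 0 = M - 1, Polynomial.monomial (e 1) (coeff e g)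
    with hB
  set D : Polynomial ℂ := B + Polynomial.monomial T (γ * ((M : ℂ) - T)) +
    Polynomial.monomial (T - 1) (γ * T) with hD
  have hBcoeff : ∀ j, (j + 2 ≤ T → T ≤ j + (2 * s + 4) → False) → B.coeff j = 0 := by
    intro j hj
    rw [hB, Polynomial.finsetSum_coeff]
    refine Finset.sum_eq_zero fun e he => ?_
    obtain ⟨he, heM⟩ := Finset.mem_filter.mp he
    rw [Polynomial.coeff_monomial, if_neg]
    rintro rfl
    exact hj (hprev e he heM).1 (hprev e he heM).2
  have hDcoeff : ∀ j, D.coeff j = B.coeff j + (if T = j then γ * ((M : ℂ) - T) else 0) +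
      if T - 1 = j then γ * T else 0 := by
    intro j
    simp [hD, Polynomial.coeff_monomial]
  have htaylor : ∀ (j r : ℕ) (x : ℂ),
      (Polynomial.taylor 1 (Polynomial.monomial j x)).coeff r = x * (j.choose r : ℂ) := by
    intro j r x
    simp [Polynomial.taylor_monomial, Polynomial.coeff_X_add_one_pow]
  have hDdvd : (Polynomial.X - 1) ^ (2 * s + 4) ∣ D := by
    refine X_sub_one_pow_dvd_iff.mpr fun r hr => ?_
    have hBr : (Polynomial.taylor 1 B).coeff r = (jet g r).coeff (M - 1) := by
      rw [hB, map_sum, Polynomial.finsetSum_coeff, coeff_jet]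
      exact Finset.sum_congr rfl fun e _ => htaylor _ _ _
    have hchoose := Nat.choose_mul_succ_eq (T - 1) r
    rw [Nat.sub_add_cancel (by omega)] at hchoose
    have hchoose' : ((T - 1).choose r : ℂ) * T = T.choose r * ((T : ℂ) - r) := by
      rw [← Nat.cast_sub (by omega)]
      exact_mod_cast hchoose
    rw [hD, map_add, map_add, Polynomial.coeff_add, Polynomial.coeff_add, htaylor, htaylor, hBr,
      hjet r hr]
    linear_combination γ * hchoose'
  have hpred : D.coeff (T - 1) = -((T : ℂ) - (T - (2 * s + 4) : ℕ)) * D.coeff T := by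
    refine coeff_pred_of_dvd (by omega) (Nat.sub_le _ _) ?_ ?_ ?_
    · refine Polynomial.natDegree_le_iff_coeff_eq_zero.mpr fun j hj => ?_
      rw [hDcoeff, hBcoeff j (by omega), if_neg (by omega), if_neg (by omega)]
      simp
    · refine Polynomial.X_pow_dvd_iff.mpr fun j hj => ?_
      rw [hDcoeff, hBcoeff j (by omega), if_neg (by omega), if_neg (by omega)]
      simp
    · rwa [Nat.sub_sub_self (by omega)]
  rw [hDcoeff, hDcoeff, hBcoeff _ (by omega), hBcoeff _ (by omega), if_neg (by omega), if_pos rfl,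
    if_pos rfl, if_neg (by omega), Nat.cast_sub (by omega)] at hpred
  have hzero : γ * (k : ℂ) = 0 := by
    rw [hTM] at hpred
    have hM' : (M : ℂ) = k * (4 * s + 5) := by rw [hM]; push_cast; ring
    push_cast at hpred
    rw [hM'] at hpred
    linear_combination -hpred
  rcases mul_eq_zero.mp hzero with h | h
  · exact hγ0 h
  · exact absurd (Nat.cast_eq_zero.mp h) (by omega)


/-- A factor whose support lies in the triangle of `no_vanishing_in_small_triangle` is constant. -/
theorem isUnit_of_small_triangle {s k : ℕ} {g : MvPolynomial (Fin 2) ℂ}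
    (hleft : ∀ e ∈ g.support, (4 * s + 5) * e 1 ≤ (4 * s + 7) * e 0)
    (hright : ∀ e ∈ g.support,
      (4 * s + 9) * e 0 ≤ 2 * e 1 + k * (16 * s ^ 2 + 48 * s + 31))
    (hwidth : ∀ e ∈ g.support, e 0 ≤ k * (4 * s + 5))
    (hchart : Polynomial.C Polynomial.X ^ (k * (4 * s + 5)) ∣ blowupChart g)
    {u : Fin 2 →₀ ℕ} (hu : u ∈ g.support) (hu0 : u 0 = k * (4 * s + 5)) : IsUnit g := by
  rcases Nat.eq_zero_or_pos k with rfl | hk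
  · have hzero : ∀ e ∈ g.support, e = 0 := by
      intro e he
      have h0 : e 0 = 0 := by simpa using hwidth e he
      have h1 := hleft e he
      rw [h0] at h1
      ext i
      fin_cases i
      · exact h0
      · simpa using h1
    obtain rfl := hzero u hu
    have hC : g = C (coeff 0 g) := by
      ext e
      rw [coeff_C]
      split_ifs with h
      · rw [h]
      · by_contra hne
        exact h (hzero e (mem_support_iff.mpr hne)).symm
    rw [hC]
    exact (IsUnit.mk0 _ (mem_support_iff.mp hu)).map C
  · exact (no_vanishing_in_small_triangle hk hleft hright hwidth hchart hu hu0).elim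

theorem exists_mem_support_of_coeff_jet_ne_zero {g : MvPolynomial (Fin 2) ℂ} {r i : ℕ}
    (h : (jet g r).coeff i ≠ 0) : ∃ e ∈ g.support, e 0 = i := by
  rw [coeff_jet] at h
  obtain ⟨e, he, -⟩ := Finset.exists_ne_zero_of_sum_ne_zero h
  exact ⟨e, Finset.mem_filter.mp he⟩

/-- In a factorization of `(1 - X) ^ m` into factors divisible by `(X - 1) ^ m₁` and
`(X - 1) ^ m₂`, with `m₁ + m₂ = m`, the factors have degree exactly `m₁` and `m₂`. -/
theorem coeff_ne_zero_of_mul_eq {P Q : Polynomial ℂ} {m₁ m₂ : ℕ}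
    (hPQ : P * Q = (1 - Polynomial.X) ^ (m₁ + m₂))
    (hP : (Polynomial.X - 1) ^ m₁ ∣ P) (hQ : (Polynomial.X - 1) ^ m₂ ∣ Q) :
    P.coeff 0 ≠ 0 ∧ P.coeff m₁ ≠ 0 := by
  have hnd : (Polynomial.X - 1 : Polynomial ℂ).natDegree = 1 := by
    simpa using Polynomial.natDegree_X_sub_C (1 : ℂ)
  have hne : P * Q ≠ 0 := by
    rw [hPQ, ← neg_sub]
    refine pow_ne_zero _ (neg_ne_zero.mpr ?_)
    rintro h
    simp [h] at hnd
  have hdeg : P.natDegree + Q.natDegree = m₁ + m₂ := by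
    rw [← Polynomial.natDegree_mul (left_ne_zero_of_mul hne) (right_ne_zero_of_mul hne), hPQ,
      ← neg_sub, Polynomial.natDegree_pow, Polynomial.natDegree_neg, hnd, mul_one]
  have h1 := Polynomial.natDegree_le_of_dvd hP (left_ne_zero_of_mul hne)
  have h2 := Polynomial.natDegree_le_of_dvd hQ (right_ne_zero_of_mul hne)
  rw [Polynomial.natDegree_pow, hnd, mul_one] at h1 h2
  constructor
  · have h0 := congrArg (Polynomial.eval 0) hPQ
    rw [Polynomial.eval_mul] at h0
    rw [Polynomial.coeff_zero_eq_eval_zero]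
    refine left_ne_zero_of_mul (b := Q.eval 0) ?_
    rw [h0]
    simp
  · have : P.natDegree = m₁ := by omega
    rw [← this, Polynomial.coeff_natDegree, Polynomial.leadingCoeff_ne_zero]
    exact left_ne_zero_of_mul hne

/-- A polynomial supported in the triangle, vanishing to order `m` at `(1, 1)` and restricting to
`(1 - x) ^ m` on `y = 1` is irreducible. -/
theorem irreducible_of_supported {s m : ℕ} (hm : m = (s + 2) * (4 * s + 5))
    {f : MvPolynomial (Fin 2) ℂ} (hwidth : ∀ e ∈ f.support, e 0 ≤ m)
    (hleft : ∀ e ∈ f.support, (4 * s + 5) * e 1 ≤ (4 * s + 7) * e 0)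
    (hright : ∀ e ∈ f.support,
      (4 * s + 9) * e 0 ≤ 2 * e 1 + ((s + 2) * (16 * s ^ 2 + 48 * s + 31) + 1))
    (hrestrict : aeval ![(Polynomial.X : Polynomial ℂ), 1] f = (1 - Polynomial.X) ^ m)
    (hchart : Polynomial.C Polynomial.X ^ m ∣ blowupChart f) : Irreducible f := by
  have hlast : ∀ e ∈ f.support, e 0 = m → (4 * s + 5) * e 1 = (4 * s + 7) * m := by
    intro e he hem
    have h1 := hleft e he
    have h2 := hright e he
    rw [hem] at h1 h2
    refine le_antisymm h1 ?_
    have h3 : (s + 2) * (4 * s + 7) ≤ e 1 := by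
      rw [hm] at h2
      nlinarith
    rw [hm]
    nlinarith
  refine ⟨fun hunit => ?_, ?_⟩
  · have h := (hunit.map (aeval ![(Polynomial.X : Polynomial ℂ), 1])).map (Polynomial.evalRingHom 1)
    rw [hrestrict] at h
    have hm0 : m ≠ 0 := by rw [hm]; positivity
    simp [hm0] at h
  rintro g h rfl
  obtain ⟨m₁, m₂, rfl, hg, hh⟩ := exists_split_multiplicity hchart
  have hgd : (Polynomial.X - 1) ^ m₁ ∣ jet g 0 := dvd_jet_of_dvd_blowupChart hg 0
  have hhd : (Polynomial.X - 1) ^ m₂ ∣ jet h 0 := dvd_jet_of_dvd_blowupChart hh 0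
  rw [map_mul, ← jet_zero, ← jet_zero] at hrestrict
  obtain ⟨hg0, hgm⟩ := coeff_ne_zero_of_mul_eq hrestrict hgd hhd
  obtain ⟨hh0, hhm⟩ := coeff_ne_zero_of_mul_eq
    (by rw [mul_comm, hrestrict, add_comm]) hhd hgd
  obtain ⟨p, hp, hp0⟩ := exists_mem_support_of_coeff_jet_ne_zero hg0
  obtain ⟨q, hq, hq0⟩ := exists_mem_support_of_coeff_jet_ne_zero hh0
  obtain ⟨u, hu, hum⟩ := exists_mem_support_of_coeff_jet_ne_zero hgm
  obtain ⟨v, hv, hvm⟩ := exists_mem_support_of_coeff_jet_ne_zero hhm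
  have hgne : g ≠ 0 := by
    rintro rfl
    simp at hp
  have hhne : h ≠ 0 := by
    rintro rfl
    simp at hq
  obtain ⟨u₀, hu₀, v₀, hv₀, huv₀, hgmax, hhmax⟩ :=
    exists_add_mem_support_mul hgne hhne (expFunctional 1 0)
  simp only [expFunctional_apply, one_mul, zero_mul, add_zero, Nat.cast_le] at hgmax hhmax
  have hsum := hwidth _ huv₀
  rw [Finsupp.add_apply] at hsum
  have hu₀' := hgmax u hu
  have hv₀' := hhmax v hv
  have hu₀m : u₀ 0 = m₁ := by omega
  have hv₀m : v₀ 0 = m₂ := by omega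
  rw [hu₀m] at hgmax
  rw [hv₀m] at hhmax
  obtain ⟨u₁, hu₁, v₁, hv₁, huv₁, hgmax₁, hhmax₁⟩ :=
    exists_add_mem_support_mul hgne hhne (expFunctional (-(4 * s + 7)) (4 * s + 5))
  have hleft₁ : ((4 * s + 5 : ℕ) : ℤ) * ((u₁ + v₁) 1 : ℕ) ≤ (4 * s + 7 : ℕ) * ((u₁ + v₁) 0 : ℕ) := by
    exact_mod_cast hleft _ huv₁
  have hgp := hgmax₁ p hp
  have hhq := hhmax₁ q hq
  simp only [expFunctional_apply, hp0, hq0, Finsupp.add_apply] at hgp hhq hgmax₁ hhmax₁ hleft₁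
  push_cast at hgp hhq hleft₁
  have hp1 : (0 : ℤ) ≤ (4 * s + 5) * (p 1 : ℕ) := by positivity
  have hq1 : (0 : ℤ) ≤ (4 * s + 5) * (q 1 : ℕ) := by positivity
  have hgleft : ∀ e ∈ g.support, (4 * s + 5) * e 1 ≤ (4 * s + 7) * e 0 := by
    intro e he
    have := hgmax₁ e he
    zify
    linarith
  have hhleft : ∀ e ∈ h.support, (4 * s + 5) * e 1 ≤ (4 * s + 7) * e 0 := by
    intro e he
    have := hhmax₁ e he
    zify
    linarith
  have htop := hlast _ huv₀ (by rw [Finsupp.add_apply]; omega)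
  rw [Finsupp.add_apply, mul_add, mul_add] at htop
  have hgtop := hgleft u₀ hu₀
  have hhtop := hhleft v₀ hv₀
  rw [hu₀m] at hgtop
  rw [hv₀m] at hhtop
  have hcop : Nat.Coprime (4 * s + 5) (4 * s + 7) := by
    have h2 : Nat.Coprime (4 * s + 5) 2 := by
      rw [Nat.coprime_two_right, Nat.odd_iff]
      omega
    simpa [add_assoc] using (Nat.coprime_self_add_right (m := 4 * s + 5) (n := 2)).mpr h2
  obtain ⟨k, rfl⟩ : 4 * s + 5 ∣ m₁ :=
    hcop.dvd_of_dvd_mul_left ⟨u₀ 1, by omega⟩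
  obtain ⟨l, rfl⟩ : 4 * s + 5 ∣ m₂ :=
    hcop.dvd_of_dvd_mul_left ⟨v₀ 1, by omega⟩
  have hkl : k + l = s + 2 := by
    refine Nat.eq_of_mul_eq_mul_right (show 0 < 4 * s + 5 by omega) ?_
    rw [← hm]; ring
  have hu₀1 : u₀ 1 = k * (4 * s + 7) := by
    refine Nat.eq_of_mul_eq_mul_left (show 0 < 4 * s + 5 by omega) ?_
    linarith
  have hv₀1 : v₀ 1 = l * (4 * s + 7) := by
    refine Nat.eq_of_mul_eq_mul_left (show 0 < 4 * s + 5 by omega) ?_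
    linarith
  obtain ⟨u₂, hu₂, v₂, hv₂, huv₂, hgmax₂, hhmax₂⟩ :=
    exists_add_mem_support_mul hgne hhne (expFunctional (4 * s + 9) (-2))
  have hright₂ : ((4 * s + 9 : ℕ) : ℤ) * ((u₂ + v₂) 0 : ℕ) ≤
      2 * ((u₂ + v₂) 1 : ℕ) + ((k + l : ℕ) * (16 * s ^ 2 + 48 * s + 31) + 1) := by
    rw [hkl]
    exact_mod_cast hright _ huv₂
  have hgk := hgmax₂ u₀ hu₀
  have hhl := hhmax₂ v₀ hv₀
  simp only [expFunctional_apply, hu₀m, hv₀m, hu₀1, hv₀1, Finsupp.add_apply]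
    at hgk hhl hgmax₂ hhmax₂ hright₂
  push_cast at hgk hhl hright₂
  rw [mul_comm (4 * s + 5) k] at hg hgmax hu₀m
  rw [mul_comm (4 * s + 5) l] at hh hhmax hv₀m
  have hor : (4 * s + 9) * (u₂ 0 : ℤ) + -2 * (u₂ 1 : ℤ) ≤ k * (16 * s ^ 2 + 48 * s + 31) ∨
      (4 * s + 9) * (v₂ 0 : ℤ) + -2 * (v₂ 1 : ℤ) ≤ l * (16 * s ^ 2 + 48 * s + 31) := by
    by_contra! hcon
    linarith [Int.add_one_le_iff.mpr hcon.1, Int.add_one_le_iff.mpr hcon.2]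
  refine hor.imp (fun hle => ?_) fun hle => ?_
  · refine isUnit_of_small_triangle hgleft (fun e he => ?_) hgmax hg hu₀ hu₀m
    have := hgmax₂ e he
    zify
    linarith
  · refine isUnit_of_small_triangle hhleft (fun e he => ?_) hhmax hh hv₀ hv₀m
    have := hhmax₂ e he
    zify
    linarith

end Bivariate

section Triangle

/-- The number of lattice points of the triangle in column `i`, for `K = 2 * s + 5`. -/
def columnCard (s i : ℕ) : ℕ :=
  (4 * s + 7) * i / (4 * s + 5) + 1 - ((4 * s + 9) * (i - (4 * s + 7) * (s + 1)) + 1) / 2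

theorem columnCard_left {s i : ℕ} (hi : i ≤ (4 * s + 7) * (s + 1)) :
    columnCard s i = i + 2 * i / (4 * s + 5) + 1 := by
  have h : (4 * s + 7) * i = 2 * i + i * (4 * s + 5) := by ring
  rw [columnCard, Nat.sub_eq_zero_of_le hi, h, Nat.add_mul_div_right _ _ (by omega), mul_zero]
  generalize 2 * i / (4 * s + 5) = z
  omega

theorem columnCard_right {s j : ℕ} (hj : j ≤ 2 * s + 2) :
    1 ≤ columnCard s ((s + 2) * (4 * s + 5) - j) ∧
      (4 * s + 7) * j ≤ 2 * columnCard s ((s + 2) * (4 * s + 5) - j) := by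
  obtain ⟨i, hi⟩ : ∃ i, i + j = (s + 2) * (4 * s + 5) :=
    ⟨_, Nat.sub_add_cancel (by nlinarith)⟩
  rw [← hi, Nat.add_sub_cancel]
  obtain ⟨t, ht⟩ : ∃ t, t + j = 2 * s + 3 := ⟨_, Nat.sub_add_cancel (by omega)⟩
  have hiw : i - (4 * s + 7) * (s + 1) = t := by
    have : i = t + (4 * s + 7) * (s + 1) := by nlinarith
    omega
  have hlo := Nat.div_mul_le_self ((4 * s + 9) * t + 1) 2
  rw [columnCard, hiw]
  set lo := ((4 * s + 9) * t + 1) / 2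
  have hsum : (4 * s + 9) * t + (4 * s + 9) * j = (4 * s + 9) * (2 * s + 3) := by
    rw [← mul_add, ht]
  have hjump : (s + 2) * (4 * s + 7) ≤ (4 * s + 7) * i / (4 * s + 5) + j + 1 := by
    have : (s + 2) * (4 * s + 7) - (j + 1) ≤ (4 * s + 7) * i / (4 * s + 5) := by
      rw [Nat.le_div_iff_mul_le (by omega), Nat.sub_mul, Nat.sub_le_iff_le_add]
      nlinarith
    omega
  have hmain : (4 * s + 7) * j ≤
      2 * ((4 * s + 7) * i / (4 * s + 5) + 1 - lo) := by
    have : (4 * s + 7) * j + 2 * lo ≤ 2 * ((4 * s + 7) * i / (4 * s + 5) + 1) := by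
      nlinarith
    omega
  refine ⟨?_, hmain⟩
  rcases Nat.eq_zero_or_pos j with rfl | hjpos
  · have hdiv : (4 * s + 7) * i / (4 * s + 5) = (s + 2) * (4 * s + 7) := by
      refine Nat.div_eq_of_eq_mul_left (by omega) ?_
      have : i = (s + 2) * (4 * s + 5) := hi
      rw [this]; ring
    have : lo ≤ (s + 2) * (4 * s + 7) := by nlinarith
    omega
  · have : 1 ≤ (4 * s + 7) * j := Nat.mul_pos (by omega) hjpos
    omega

theorem one_le_columnCard {s i : ℕ} (hi : i ≤ (s + 2) * (4 * s + 5)) : 1 ≤ columnCard s i := by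
  rcases le_or_gt i ((4 * s + 7) * (s + 1)) with h | h
  · rw [columnCard_left h]
    exact Nat.le_add_left _ _
  · have hj := (columnCard_right (s := s) (j := (s + 2) * (4 * s + 5) - i)
      (by rw [tsub_le_iff_right]; nlinarith)).1
    rwa [Nat.sub_sub_self hi] at hj

/-- At most `r + 1` columns of the triangle have at most `r` lattice points. -/
theorem card_columnCard_le (s r : ℕ) :
    ((Finset.range ((s + 2) * (4 * s + 5) + 1)).filter fun i => columnCard s i ≤ r).card ≤
      r + 1 := by
  set J := 2 * r / (4 * s + 7) with hJ
  have hJr : (4 * s + 7) * J ≤ 2 * r := Nat.mul_div_le _ _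
  have hsub : ((Finset.range ((s + 2) * (4 * s + 5) + 1)).filter fun i => columnCard s i ≤ r) ⊆
      Finset.range (r - J) ∪
        (Finset.range (J + 1)).image fun j => (s + 2) * (4 * s + 5) - j := by
    intro i hi
    rw [Finset.mem_filter, Finset.mem_range] at hi
    obtain ⟨him, hir⟩ := hi
    rw [Finset.mem_union, Finset.mem_range, Finset.mem_image]
    rcases le_or_gt i ((4 * s + 7) * (s + 1)) with h | h
    · left
      rw [columnCard_left h] at hir
      by_contra hcon
      have hle : J ≤ 2 * i / (4 * s + 5) := by
        rw [Nat.le_div_iff_mul_le (by omega)]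
        have : r ≤ i + J := by omega
        nlinarith
      omega
    · right
      have hj := (columnCard_right (s := s) (j := (s + 2) * (4 * s + 5) - i)
        (by rw [tsub_le_iff_right]; nlinarith)).2
      rw [Nat.sub_sub_self (by omega)] at hj
      refine ⟨(s + 2) * (4 * s + 5) - i, ?_, Nat.sub_sub_self (by omega)⟩
      rw [Finset.mem_range, Nat.lt_succ_iff, hJ, Nat.le_div_iff_mul_le (by omega), mul_comm]
      omega
  refine (Finset.card_le_card hsub).trans ((Finset.card_union_le _ _).trans ?_)
  have h1 := Finset.card_image_le (s := Finset.range (J + 1))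
    (f := fun j => (s + 2) * (4 * s + 5) - j)
  rw [Finset.card_range] at h1 ⊢
  have : J ≤ r := by nlinarith
  omega

/-- Membership in the triangle with vertices `(0, 0)`, `(w, 0)` and `(p, q)`. -/
theorem mem_convexHull_triangle {w p q x y : ℝ} (hw : 0 < w) (hq : 0 < q) (hy : 0 ≤ y)
    (hleft : p * y ≤ q * x) (hright : q * (x - w) ≤ (p - w) * y) :
    (x, y) ∈ convexHull ℝ ({((0 : ℝ), (0 : ℝ)), (w, 0), (p, q)} : Set (ℝ × ℝ)) := by
  have hmem := (convex_convexHull ℝ ({((0 : ℝ), (0 : ℝ)), (w, 0), (p, q)} : Set (ℝ × ℝ))).sum_mem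
    (t := Finset.univ) (w := ![1 - (q * x - p * y) / (q * w) - y / q,
      (q * x - p * y) / (q * w), y / q]) (z := ![((0 : ℝ), (0 : ℝ)), (w, 0), (p, q)])
    ?_ ?_ ?_
  · rw [Fin.sum_univ_three] at hmem
    convert hmem using 1
    ext
    · simp
      field_simp
      ring
    · simp
      field_simp
  · intro i _
    fin_cases i
    · have : 1 - (q * x - p * y) / (q * w) - y / q = ((p - w) * y - q * (x - w)) / (q * w) := by
        field_simp
        ring
      simp only [Fin.zero_eta, Matrix.cons_val_zero, this]
      exact div_nonneg (sub_nonneg.mpr hright) (by positivity)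
    · exact div_nonneg (sub_nonneg.mpr hleft) (by positivity)
    · exact div_nonneg hy hq.le
  · simp [Fin.sum_univ_three]
    ring
  · intro i _
    refine subset_convexHull ℝ _ ?_
    fin_cases i <;> simp

end Triangle

end NegativeCurve

open MvPolynomial

theorem stmt9 (K : ℤ) (hK : 5 ≤ K) (hKodd : Odd K)
    (a c d : ℤ) (m : ℕ) (ha : a = 2 * K - 3) (hc : c = 4 * K ^ 2 - 16 * K + 11)
    (hd : d = 2 * K - 5)
    (hm : 2 * (m : ℤ) = 2 * K ^ 2 - 7 * K + 5) :
    ∃ f : MvPolynomial (Fin 2) ℂ, f ≠ 0 ∧ Irreducible f ∧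
      (∀ e ∈ f.support,
        ((e 0 : ℝ), (e 1 : ℝ)) ∈ convexHull ℝ
          ({((0 : ℝ), (0 : ℝ)), ((m : ℝ) - (K : ℝ) + 2, 0),
            (((K : ℝ) - 1) / 2 + 1 / (c : ℝ)) • ((d : ℝ), (a : ℝ))} : Set (ℝ × ℝ))) ∧
      f ∈ (Ideal.span {X 0 - 1, X 1 - 1} : Ideal (MvPolynomial (Fin 2) ℂ)) ^ m := by
  obtain ⟨s, rfl⟩ : ∃ s : ℕ, K = 2 * s + 5 := by
    obtain ⟨t, rfl⟩ := hKodd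
    exact ⟨(t - 2).toNat, by omega⟩
  obtain rfl : m = (s + 2) * (4 * s + 5) := by
    zify
    linarith
  obtain ⟨f, hsupp, hrestrict, hmem⟩ := NegativeCurve.exists_supported_vanishing
    ((s + 2) * (4 * s + 5)) (fun i => ((4 * s + 9) * (i - (4 * s + 7) * (s + 1)) + 1) / 2)
    (NegativeCurve.columnCard s) (fun i => NegativeCurve.one_le_columnCard)
    (NegativeCurve.card_columnCard_le s) (Nat.mul_pos (by omega) (by omega))
  have hleft : ∀ e ∈ f.support, (4 * s + 5) * e 1 ≤ (4 * s + 7) * e 0 := by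
    intro e he
    obtain ⟨-, h1, h2⟩ := hsupp e he
    rw [NegativeCurve.columnCard] at h2
    have : e 1 ≤ (4 * s + 7) * e 0 / (4 * s + 5) := by omega
    rwa [Nat.le_div_iff_mul_le (by omega), mul_comm] at this
  have hright : ∀ e ∈ f.support, (4 * s + 9) * e 0 ≤
      2 * e 1 + (4 * s + 9) * ((4 * s + 7) * (s + 1)) := by
    intro e he
    obtain ⟨-, h1, -⟩ := hsupp e he
    rcases le_total (e 0) ((4 * s + 7) * (s + 1)) with h | h
    · exact (Nat.mul_le_mul_left _ h).trans (Nat.le_add_left _ _)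
    · obtain ⟨t, ht⟩ := Nat.exists_eq_add_of_le h
      rw [ht, Nat.add_sub_cancel_left] at h1
      rw [ht, mul_add]
      omega
  have hirr : Irreducible f := by
    refine NegativeCurve.irreducible_of_supported rfl (fun e he => (hsupp e he).1) hleft
      (fun e he => (hright e he).trans (le_of_eq (by ring))) hrestrict
      (NegativeCurve.dvd_blowupChart_of_mem hmem)
  refine ⟨f, hirr.ne_zero, hirr, fun e he => ?_, hmem⟩
  have hl : ((4 * s + 5 : ℕ) : ℝ) * (e 1 : ℕ) ≤ (4 * s + 7 : ℕ) * (e 0 : ℕ) := by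
    exact_mod_cast hleft e he
  have hr : ((4 * s + 9 : ℕ) : ℝ) * (e 0 : ℕ) ≤
      2 * (e 1 : ℕ) + (4 * s + 9 : ℕ) * ((4 * s + 7 : ℕ) * (s + 1 : ℕ)) := by
    exact_mod_cast hright e he
  push_cast at hl hr
  set x : ℝ := (e 0 : ℝ)
  set y : ℝ := (e 1 : ℝ)
  have hc' : (c : ℝ) = 16 * s ^ 2 + 48 * s + 31 := by
    rw [hc]; push_cast; ring
  have hcpos : (0 : ℝ) < c := by rw [hc']; positivity
  have hw : (((s + 2) * (4 * s + 5) : ℕ) : ℝ) - ((2 * s + 5 : ℤ) : ℝ) + 2 =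
      (4 * s + 7) * (s + 1) := by
    push_cast; ring
  have ht : (((2 * s + 5 : ℤ) : ℝ) - 1) / 2 + 1 / (c : ℝ) =
      (4 * s + 9) * ((4 * s + 7) * (s + 1)) / c := by
    field_simp
    rw [hc']
    push_cast
    ring
  have hd' : (d : ℝ) = 4 * s + 5 := by rw [hd]; push_cast; ring
  have ha' : (a : ℝ) = 4 * s + 7 := by rw [ha]; push_cast; ring
  rw [hw, ht, Prod.smul_mk, smul_eq_mul, smul_eq_mul, hd', ha']
  refine NegativeCurve.mem_convexHull_triangle (by positivity) (by positivity) (by positivity) ?_ ?_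
  · rw [mul_assoc, mul_assoc]
    exact mul_le_mul_of_nonneg_left hl (by positivity)
  · rw [← sub_nonneg]
    have : ((4 * s + 9) * ((4 * s + 7) * (s + 1)) / c * (4 * s + 5) - (4 * s + 7) * (s + 1)) * y -
        (4 * s + 9) * ((4 * s + 7) * (s + 1)) / c * (4 * s + 7) * (x - (4 * s + 7) * (s + 1)) =
        (4 * s + 7) * (s + 1) * (4 * s + 7) / c *
          (2 * y + (4 * s + 9) * ((4 * s + 7) * (s + 1)) - (4 * s + 9) * x) := by
      field_simp
      rw [hc']
      ring
    rw [this]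
    exact mul_nonneg (by positivity) (sub_nonneg.mpr hr)
end

section
/- Let K >= 4 be an integer and set N = K-2, M = N^2 - 1, m = N(M+N) - 1. Then there exists an irreducible polynomial f ∈ C[x,y] lying in the m-th power of the ideal (x-1, y-1) of C[x,y] whose Newton polygon (the convex hull of the exponent pairs of its nonzero monomials) equals the convex hull of the five points (0,0), (MN-1, 0), (N(M+N)-1, K*N^2-1), (M+N-1, K*N-1), (N-1, N). -/
open MvPolynomial

namespace NegativeCurve

section Weights

variable {Γ : Type*} [AddCommGroup Γ] [LinearOrder Γ]

/-- Every exponent of `f` has `D`-weight at most `d`. -/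
def Below (D : (Fin 2 →₀ ℕ) →+ Γ) (f : MvPolynomial (Fin 2) ℂ) (d : Γ) : Prop :=
  ∀ e, coeff e f ≠ 0 → D e ≤ d

/-- The exponent `e` occurs in `f` and has the largest `D`-weight among the exponents of `f`. -/
def IsTop (D : (Fin 2 →₀ ℕ) →+ Γ) (f : MvPolynomial (Fin 2) ℂ) (e : Fin 2 →₀ ℕ) : Prop :=
  coeff e f ≠ 0 ∧ Below D f (D e)

variable {D : (Fin 2 →₀ ℕ) →+ Γ} {f g : MvPolynomial (Fin 2) ℂ} {d d' : Γ}
  {e e' : Fin 2 →₀ ℕ}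

lemma exists_of_coeff_mul_ne_zero (h : coeff e (f * g) ≠ 0) :
    ∃ a b, coeff a f ≠ 0 ∧ coeff b g ≠ 0 ∧ a + b = e := by
  rw [coeff_mul] at h
  obtain ⟨x, hx, hne⟩ := Finset.exists_ne_zero_of_sum_ne_zero h
  exact ⟨x.1, x.2, left_ne_zero_of_mul hne, right_ne_zero_of_mul hne,
    Finset.HasAntidiagonal.mem_antidiagonal.1 hx⟩

lemma Below.mono (h : Below D f d) (hd : d ≤ d') : Below D f d' :=
  fun e he => (h e he).trans hd

lemma Below.add (hf : Below D f d) (hg : Below D g d) : Below D (f + g) d := by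
  intro e he
  by_cases h : coeff e f = 0
  · exact hg e fun h' => he (by rw [coeff_add, h, h', add_zero])
  · exact hf e h

lemma Below.neg (hf : Below D f d) : Below D (-f) d :=
  fun e he => hf e fun h => he (by rw [coeff_neg, h, neg_zero])

lemma Below.sub (hf : Below D f d) (hg : Below D g d) : Below D (f - g) d := by
  rw [sub_eq_add_neg]
  exact hf.add hg.neg

lemma below_C (c : ℂ) : Below D (C c) 0 := by
  intro e he
  rw [coeff_C] at he
  obtain rfl : 0 = e := by
    by_contra h
    exact he (if_neg h)
  rw [map_zero]

lemma below_one : Below D 1 0 := below_C 1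

lemma Below.sum {ι : Type*} {s : Finset ι} {F : ι → MvPolynomial (Fin 2) ℂ}
    (h : ∀ i ∈ s, Below D (F i) d) : Below D (∑ i ∈ s, F i) d := by
  intro e he
  rw [coeff_sum] at he
  obtain ⟨i, hi, hne⟩ := Finset.exists_ne_zero_of_sum_ne_zero he
  exact h i hi e hne

lemma isTop_X (i : Fin 2) : IsTop D (X i) (Finsupp.single i 1) := by
  refine ⟨by simp, fun e he => ?_⟩
  rw [coeff_X] at he
  obtain rfl : Finsupp.single i 1 = e := by
    by_contra h
    exact he (if_neg h)
  rfl

lemma isTop_one : IsTop D 1 0 :=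
  ⟨by simp, by rw [map_zero]; exact below_one⟩

lemma IsTop.neg (h : IsTop D f e) : IsTop D (-f) e :=
  ⟨by rw [coeff_neg]; exact neg_ne_zero.2 h.1, h.2.neg⟩

lemma IsTop.add_of_lt (hf : IsTop D f e) (hg : Below D g d) (hd : d < D e) :
    IsTop D (f + g) e := by
  refine ⟨?_, hf.2.add (hg.mono hd.le)⟩
  have : coeff e g = 0 := by
    by_contra h
    exact (hg e h).not_gt hd
  rw [coeff_add, this, add_zero]
  exact hf.1

lemma IsTop.sub_of_lt (hf : IsTop D f e) (hg : Below D g d) (hd : d < D e) :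
    IsTop D (f - g) e := by
  rw [sub_eq_add_neg]
  exact hf.add_of_lt hg.neg hd

lemma exists_isTop (D : (Fin 2 →₀ ℕ) →+ Γ) (hf : f ≠ 0) : ∃ e, IsTop D f e := by
  obtain ⟨e, he, hmax⟩ := f.support.exists_max_image D (support_nonempty.2 hf)
  exact ⟨e, mem_support_iff.1 he, fun e' he' => hmax e' (mem_support_iff.2 he')⟩

lemma IsTop.eq (hD : Function.Injective D) (h : IsTop D f e) (h' : IsTop D f e') : e = e' :=
  hD ((h'.2 e h.1).antisymm (h.2 e' h'.1))

lemma IsTop.ne_zero (hf : IsTop D f e) : f ≠ 0 := by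
  rintro rfl
  exact hf.1 (coeff_zero e)

variable [IsOrderedAddMonoid Γ]

lemma Below.mul (hf : Below D f d) (hg : Below D g d') : Below D (f * g) (d + d') := by
  intro e he
  obtain ⟨a, b, ha, hb, rfl⟩ := exists_of_coeff_mul_ne_zero he
  rw [map_add]
  exact add_le_add (hf a ha) (hg b hb)

lemma Below.pow (hf : Below D f d) (n : ℕ) : Below D (f ^ n) (n • d) := by
  induction n with
  | zero => simpa using below_one
  | succ n ih =>
    rw [pow_succ, succ_nsmul]
    exact ih.mul hf

lemma IsTop.mul (hD : Function.Injective D) (hf : IsTop D f e) (hg : IsTop D g e') :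
    IsTop D (f * g) (e + e') := by
  refine ⟨?_, by rw [map_add]; exact hf.2.mul hg.2⟩
  rw [coeff_mul, Finset.sum_eq_single (e, e')]
  · exact mul_ne_zero hf.1 hg.1
  · rintro ⟨a, b⟩ hab hne
    by_contra h
    have ha := hf.2 a (left_ne_zero_of_mul h)
    have hb := hg.2 b (right_ne_zero_of_mul h)
    have hs : a + b = e + e' := Finset.HasAntidiagonal.mem_antidiagonal.1 hab
    have hDs : D a + D b = D e + D e' := by rw [← map_add, hs, map_add]
    have hae : a = e := hD (ha.antisymm (by
      by_contra hlt
      exact (add_lt_add_of_lt_of_le (not_le.1 hlt) hb).ne hDs))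
    subst hae
    exact hne (by rw [add_left_cancel hs])
  · intro h
    exact absurd (by rw [Finset.HasAntidiagonal.mem_antidiagonal]) h

lemma IsTop.pow (hD : Function.Injective D) (hf : IsTop D f e) (n : ℕ) :
    IsTop D (f ^ n) (n • e) := by
  induction n with
  | zero => simpa using isTop_one
  | succ n ih =>
    rw [pow_succ, succ_nsmul]
    exact ih.mul hD hf

lemma IsTop.of_mul (hD : Function.Injective D) (h : IsTop D (f * g) e) (hg : IsTop D g e') :
    ∃ a, IsTop D f a ∧ a + e' = e := by
  obtain ⟨a, ha⟩ := exists_isTop D (left_ne_zero_of_mul h.ne_zero)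
  exact ⟨a, ha, (ha.mul hD hg).eq hD h⟩

end Weights

/-- The linear weight `e ↦ p * e 0 + q * e 1`. -/
def weight (p q : ℤ) : (Fin 2 →₀ ℕ) →+ ℤ where
  toFun e := p * e 0 + q * e 1
  map_zero' := by simp
  map_add' a b := by simp; ring

/-- The weight `e ↦ p * e 0 + q * e 1`, refined lexicographically by `e ↦ r * e 0`. -/
def lexWeight (p q r : ℤ) : (Fin 2 →₀ ℕ) →+ ℤ ×ₗ ℤ where
  toFun e := toLex (p * e 0 + q * e 1, r * e 0)
  map_zero' := by simp
  map_add' a b := by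
    rw [← toLex_add, Prod.mk_add_mk]
    simp only [Finsupp.add_apply]
    push_cast
    congr 2 <;> ring

lemma weight_apply (p q : ℤ) (e : Fin 2 →₀ ℕ) : weight p q e = p * e 0 + q * e 1 := rfl

lemma lexWeight_le {p q r : ℤ} {e e' : Fin 2 →₀ ℕ} :
    lexWeight p q r e ≤ lexWeight p q r e' ↔ p * e 0 + q * e 1 < p * e' 0 + q * e' 1 ∨
      p * e 0 + q * e 1 = p * e' 0 + q * e' 1 ∧ r * e 0 ≤ r * e' 0 :=
  Prod.Lex.toLex_le_toLex

lemma lexWeight_lt {p q r : ℤ} {e e' : Fin 2 →₀ ℕ} :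
    lexWeight p q r e < lexWeight p q r e' ↔ p * e 0 + q * e 1 < p * e' 0 + q * e' 1 ∨
      p * e 0 + q * e 1 = p * e' 0 + q * e' 1 ∧ r * e 0 < r * e' 0 :=
  Prod.Lex.toLex_lt_toLex

lemma lexWeight_injective {p q r : ℤ} (hq : q ≠ 0) (hr : r ≠ 0) :
    Function.Injective (lexWeight p q r) := by
  intro a b h
  obtain ⟨h₁, h₂⟩ := Prod.mk.inj (toLex.injective h)
  have h0 : (a 0 : ℤ) = b 0 := mul_left_cancel₀ hr h₂
  have h1 : (a 1 : ℤ) = b 1 := mul_left_cancel₀ hq (by rw [h0] at h₁; linarith)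
  ext i
  fin_cases i
  · exact_mod_cast h0
  · exact_mod_cast h1

section Construction

variable {R : Type*} [CommRing R]

/-- The polynomials `((1 - x y) ^ (n + 1) - x ^ n (1 - y) ^ (n + 1)) / (1 - x)`, of order `n` at
`(1, 1)`. -/
def alpha (x y : R) : ℕ → R
  | 0 => y
  | n + 1 => (1 - x * y) * alpha x y n + x ^ n * (1 - y) ^ (n + 1)

lemma alpha_succ (x y : R) (n : ℕ) :
    alpha x y (n + 1) = (1 - x * y) * alpha x y n + x ^ n * (1 - y) ^ (n + 1) := rfl

lemma alpha_succ' (x y : R) (n : ℕ) :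
    alpha x y (n + 1) = x * (1 - y) * alpha x y n + (1 - x * y) ^ (n + 1) := by
  induction n with
  | zero => simp only [alpha]; ring
  | succ n ih =>
    conv_lhs => rw [alpha_succ, ih]
    conv_rhs => rw [alpha_succ]
    ring

lemma map_alpha {S : Type*} [CommRing S] (φ : R →+* S) (x y : R) (n : ℕ) :
    φ (alpha x y n) = alpha (φ x) (φ y) n := by
  induction n with
  | zero => rfl
  | succ n ih => simp [alpha_succ, ih]

/-- The quotient `(alpha (n + 2) ^ (n + 4) - (-1) ^ n x ^ r (1 - y) ^ s) / alpha (n + 3)`, where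
`r = n ^ 2 + 5 n + 5` and `s = (n + 2) (n + 4)`, of order `r` at `(1, 1)`. -/
def xi (x y : R) (n : ℕ) : R :=
  alpha x y (n + 2) ^ (n + 2) * alpha x y (n + 1) + x ^ (n + 1) * (1 - y) ^ (n + 2) *
    ∑ k ∈ Finset.range (n + 2), ((1 - x * y) * alpha x y (n + 2)) ^ k *
      (-(x ^ (n + 2) * (1 - y) ^ (n + 3))) ^ (n + 1 - k)

lemma mul_xi_mul_alpha (x y : R) (n : ℕ) :
    x * (1 - y) * (xi x y n * alpha x y (n + 3)) =
      x * (1 - y) * (alpha x y (n + 2) ^ (n + 4) -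
        (-1) ^ n * x ^ (n ^ 2 + 5 * n + 5) * (1 - y) ^ ((n + 2) * (n + 4))) := by
  have h₁ := alpha_succ x y (n + 2)
  have h₂ := alpha_succ' x y (n + 2)
  have h₃ := alpha_succ' x y (n + 1)
  have hs := Commute.geom_sum₂_mul
    (Commute.all ((1 - x * y) * alpha x y (n + 2)) (-(x ^ (n + 2) * (1 - y) ^ (n + 3)))) (n + 2)
  simp only [show n + 2 - 1 = n + 1 from rfl] at hs
  have hc : x ^ (n + 2) * (1 - y) ^ (n + 3) =
      x * (1 - y) * (x ^ (n + 1) * (1 - y) ^ (n + 2)) := by ring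
  have hx : x * (1 - y) * (x ^ (n ^ 2 + 5 * n + 5) * (1 - y) ^ ((n + 2) * (n + 4))) =
      (x ^ (n + 2) * (1 - y) ^ (n + 3)) ^ (n + 3) := by
    generalize 1 - y = v
    ring
  have hxi : x * (1 - y) * xi x y n = alpha x y (n + 2) ^ (n + 2) *
      (x * (1 - y) * alpha x y (n + 1)) + x ^ (n + 2) * (1 - y) ^ (n + 3) *
    ∑ k ∈ Finset.range (n + 2), ((1 - x * y) * alpha x y (n + 2)) ^ k *
      (-(x ^ (n + 2) * (1 - y) ^ (n + 3))) ^ (n + 1 - k) := by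
    rw [xi, hc]; ring
  rw [← mul_assoc, hxi, mul_sub (x * (1 - y)), mul_assoc ((-1 : R) ^ n),
    mul_left_comm _ ((-1 : R) ^ n), hx]
  generalize (∑ k ∈ Finset.range (n + 2), ((1 - x * y) * alpha x y (n + 2)) ^ k *
      (-(x ^ (n + 2) * (1 - y) ^ (n + 3))) ^ (n + 1 - k)) = S at *
  have h₁' : alpha x y (n + 3) =
    (1 - x * y) * alpha x y (n + 2) + x ^ (n + 2) * (1 - y) ^ (n + 3) := h₁
  have h₂' : x * (1 - y) * alpha x y (n + 2) = alpha x y (n + 3) - (1 - x * y) ^ (n + 3) := by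
    rw [show alpha x y (n + 3) = _ from h₂]; ring
  have h₃' : x * (1 - y) * alpha x y (n + 1) = alpha x y (n + 2) - (1 - x * y) ^ (n + 2) := by
    rw [show alpha x y (n + 2) = _ from h₃]; ring
  have h₄ : x * (1 - y) * alpha x y (n + 2) ^ (n + 4) =
      alpha x y (n + 2) ^ (n + 3) * (alpha x y (n + 3) - (1 - x * y) ^ (n + 3)) := by
    rw [← h₂']; ring
  rw [h₃', h₄]
  generalize x ^ (n + 2) * (1 - y) ^ (n + 3) = c at *
  generalize alpha x y (n + 3) = b at *
  generalize alpha x y (n + 2) = a at *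
  generalize 1 - x * y = w at *
  have hs' : S * b = (w * a) ^ (n + 2) - (-c) ^ (n + 2) := by rw [← hs, h₁']; ring
  rw [add_mul, mul_assoc c, hs']
  rw [neg_pow c, mul_pow w a]
  have h₅ : c = b - w * a := by rw [h₁']; ring
  have h₆ : c * (w ^ (n + 2) * a ^ (n + 2)) = (b - w * a) * (w ^ (n + 2) * a ^ (n + 2)) := by
    rw [← h₅]
  linear_combination h₆

end Construction

section Order

variable {R : Type*} [CommRing R] {I : Ideal R} {t : R}

/-- `f` and `g` lie in `I ^ (p + 1)` and are congruent modulo `t I ^ p`. -/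
def CongrModMul (I : Ideal R) (t : R) (p : ℕ) (f g : R) : Prop :=
  f ∈ I ^ (p + 1) ∧ g ∈ I ^ (p + 1) ∧ ∃ h ∈ I ^ p, f - g = t * h

lemma CongrModMul.mul {p q : ℕ} {f g f' g' : R} (h : CongrModMul I t p f g)
    (h' : CongrModMul I t q f' g') : CongrModMul I t (p + q + 1) (f * f') (g * g') := by
  obtain ⟨hf, hg, k, hk, hfg⟩ := h
  obtain ⟨hf', hg', k', hk', hfg'⟩ := h'
  refine ⟨?_, ?_, k * f' + g * k', ?_, by linear_combination f' * hfg + g * hfg'⟩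
  · rw [show p + q + 1 + 1 = (p + 1) + (q + 1) by ring, pow_add]
    exact Ideal.mul_mem_mul hf hf'
  · rw [show p + q + 1 + 1 = (p + 1) + (q + 1) by ring, pow_add]
    exact Ideal.mul_mem_mul hg hg'
  · refine Ideal.add_mem _ ?_ ?_
    · rw [show p + q + 1 = p + (q + 1) by ring, pow_add]
      exact Ideal.mul_mem_mul hk hf'
    · rw [show p + q + 1 = (p + 1) + q by ring, pow_add]
      exact Ideal.mul_mem_mul hg hk'

lemma CongrModMul.pow {p : ℕ} {f g : R} (h : CongrModMul I t p f g) (n : ℕ) :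
    CongrModMul I t (p * (n + 1) + n) (f ^ (n + 1)) (g ^ (n + 1)) := by
  induction n with
  | zero => simpa using h
  | succ n ih =>
    rw [pow_succ f, pow_succ g, show p * (n + 1 + 1) + (n + 1) = p * (n + 1) + n + p + 1 by ring]
    exact ih.mul h

variable {x y : R}

lemma alpha_mem (hv : 1 - y ∈ I) (hw : 1 - x * y ∈ I) (n : ℕ) : alpha x y n ∈ I ^ n := by
  induction n with
  | zero => simp
  | succ n ih =>
    rw [alpha_succ, pow_succ' I]
    refine Ideal.add_mem _ (Ideal.mul_mem_mul hw ih) (Ideal.mul_mem_left _ _ ?_)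
    rw [← pow_succ' I]
    exact Ideal.pow_mem_pow hv _

lemma congrModMul_alpha (hv : 1 - y ∈ I) (hw : 1 - x * y ∈ I) (n : ℕ) :
    CongrModMul I (x * (1 - y)) n (alpha x y (n + 1)) ((1 - x * y) ^ (n + 1)) :=
  ⟨alpha_mem hv hw _, Ideal.pow_mem_pow hw _, alpha x y n, alpha_mem hv hw n, by
    rw [alpha_succ']; ring⟩

lemma congrModMul_xi (hv : 1 - y ∈ I) (hw : 1 - x * y ∈ I) (n : ℕ) :
    CongrModMul I (x * (1 - y)) (n ^ 2 + 5 * n + 4) (xi x y n)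
      ((1 - x * y) ^ (n ^ 2 + 5 * n + 5)) := by
  set S := ∑ k ∈ Finset.range (n + 2), ((1 - x * y) * alpha x y (n + 2)) ^ k *
      (-(x ^ (n + 2) * (1 - y) ^ (n + 3))) ^ (n + 1 - k) with hS
  have hSmem : S ∈ I ^ ((n + 3) * (n + 1)) := by
    refine Ideal.sum_mem _ fun k hk => ?_
    have hk' : k ≤ n + 1 := Nat.lt_succ_iff.1 (Finset.mem_range.1 hk)
    have hsplit : I ^ ((n + 3) * (n + 1)) = (I ^ (n + 3)) ^ k * (I ^ (n + 3)) ^ (n + 1 - k) := by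
      rw [← pow_add, ← pow_mul, Nat.add_sub_of_le hk']
    rw [hsplit]
    refine Ideal.mul_mem_mul (Ideal.pow_mem_pow ?_ _) (Ideal.pow_mem_pow ?_ _)
    · rw [pow_succ' I]
      exact Ideal.mul_mem_mul hw (alpha_mem hv hw _)
    · exact neg_mem (Ideal.mul_mem_left _ _ (Ideal.pow_mem_pow hv _))
  obtain ⟨h₁, h₂, h, hh, h₃⟩ := ((congrModMul_alpha hv hw (n + 1)).pow (n + 1)).mul
    (congrModMul_alpha hv hw n)
  have e₁ : (n + 1) * (n + 1 + 1) + (n + 1) + n + 1 = n ^ 2 + 5 * n + 4 := by ring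
  rw [e₁] at h₁ h₂ hh
  have hT : x ^ n * (1 - y) ^ (n + 1) * S ∈ I ^ (n ^ 2 + 5 * n + 4) := by
    rw [mul_assoc, show n ^ 2 + 5 * n + 4 = (n + 1) + (n + 3) * (n + 1) by ring, pow_add]
    exact Ideal.mul_mem_left _ _ (Ideal.mul_mem_mul (Ideal.pow_mem_pow hv _) hSmem)
  refine ⟨?_, Ideal.pow_mem_pow hw _, h + x ^ n * (1 - y) ^ (n + 1) * S, Ideal.add_mem _ hh hT, ?_⟩
  · rw [xi]
    refine Ideal.add_mem _ h₁ ?_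
    rw [mul_assoc, show n ^ 2 + 5 * n + 4 + 1 = (n + 2) + (n + 3) * (n + 1) by ring, pow_add]
    exact Ideal.mul_mem_left _ _ (Ideal.mul_mem_mul (Ideal.pow_mem_pow hv _) hSmem)
  · rw [mul_add, ← h₃, xi, ← hS]
    generalize S = S
    generalize 1 - x * y = w
    generalize 1 - y = v
    ring

lemma exists_mem_pow (hv : 1 - y ∈ I) (hw : 1 - x * y ∈ I) (n : ℕ) :
    ∃ f ∈ I ^ ((n + 2) * (n ^ 2 + 5 * n + 5) - 1),
      x * (1 - y) * f = xi x y n ^ (n + 2) - alpha x y (n + 2) ^ (n ^ 2 + 5 * n + 5) := by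
  obtain ⟨-, -, f, hf, hfe⟩ := (congrModMul_xi hv hw n).pow (n + 1)
  obtain ⟨-, -, g, hg, hge⟩ := (congrModMul_alpha hv hw (n + 1)).pow (n ^ 2 + 5 * n + 4)
  have e₁ : (n ^ 2 + 5 * n + 4) * (n + 1 + 1) + (n + 1) = (n + 2) * (n ^ 2 + 5 * n + 5) - 1 := by
    rw [eq_tsub_iff_add_eq_of_le (Nat.succ_le_of_lt (by positivity))]; ring
  have e₂ : (n + 1) * (n ^ 2 + 5 * n + 4 + 1) + (n ^ 2 + 5 * n + 4) =
      (n + 2) * (n ^ 2 + 5 * n + 5) - 1 := by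
    rw [eq_tsub_iff_add_eq_of_le (Nat.succ_le_of_lt (by positivity))]; ring
  rw [e₁] at hf
  rw [e₂] at hg
  refine ⟨f - g, Ideal.sub_mem _ hf hg, ?_⟩
  rw [mul_sub, ← hfe, ← hge]
  generalize 1 - x * y = w
  ring

end Order

/-- The exponent of the monomial `x ^ i * y ^ j`. -/
noncomputable def expo (i j : ℕ) : Fin 2 →₀ ℕ := i • Finsupp.single 0 1 + j • Finsupp.single 1 1

@[simp] lemma expo_apply_zero (i j : ℕ) : expo i j 0 = i := by simp [expo]

@[simp] lemma expo_apply_one (i j : ℕ) : expo i j 1 = j := by simp [expo]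

lemma eq_expo {e : Fin 2 →₀ ℕ} {i j : ℕ} (h₀ : e 0 = i) (h₁ : e 1 = j) : e = expo i j := by
  ext k
  fin_cases k <;> simp [h₀, h₁]

lemma expo_zero : expo 0 0 = 0 := by simp [expo]

lemma expo_add (i j i' j' : ℕ) : expo i j + expo i' j' = expo (i + i') (j + j') :=
  eq_expo (by simp) (by simp)

lemma nsmul_expo (k i j : ℕ) : k • expo i j = expo (k * i) (k * j) :=
  eq_expo (by simp) (by simp)

section Basic

variable {Γ : Type*} [AddCommGroup Γ] [LinearOrder Γ]
  {D : (Fin 2 →₀ ℕ) →+ Γ}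

lemma below_X (i : Fin 2) : Below D (X i) (D (Finsupp.single i 1)) := (isTop_X i).2

lemma isTop_one_sub_X_of_pos (h : 0 < D (Finsupp.single 1 1)) :
    IsTop D (1 - X 1) (expo 0 1) := by
  have := ((isTop_X (D := D) 1).sub_of_lt below_one h).neg
  rwa [neg_sub, show Finsupp.single 1 1 = expo 0 1 by simp [expo]] at this

lemma isTop_one_sub_X_of_neg (h : D (Finsupp.single 1 1) < 0) : IsTop D (1 - X 1) (expo 0 0) := by
  rw [expo_zero]
  exact isTop_one.sub_of_lt (below_X 1) (by rwa [map_zero])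

lemma isTop_neg_one_pow_mul {f : MvPolynomial (Fin 2) ℂ} {e : Fin 2 →₀ ℕ} (h : IsTop D f e)
    (k : ℕ) : IsTop D ((-1) ^ k * f) e := by
  rcases neg_one_pow_eq_or (MvPolynomial (Fin 2) ℂ) k with hk | hk <;> rw [hk]
  · rwa [one_mul]
  · rw [neg_one_mul]
    exact h.neg

lemma isTop_X_zero : IsTop D (X 0) (expo 1 0) := by
  simpa [expo] using isTop_X (D := D) 0

end Basic

section Alpha

lemma exists_alpha_eq (n : ℕ) : ∃ B : MvPolynomial (Fin 2) ℂ,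
    alpha (X 0) (X 1) n = (-1) ^ n * (X 0 ^ n * X 1 ^ (n + 1)) + B ∧
      Below (weight (-1) 1) B 0 ∧ Below (weight 1 0) B (n - 1) := by
  induction n with
  | zero => exact ⟨0, by simp [alpha], fun e he => absurd (coeff_zero e) he,
      fun e he => absurd (coeff_zero e) he⟩
  | succ n ih =>
    obtain ⟨B, hB, h₁, h₂⟩ := ih
    have hs := Commute.geom_sum₂_mul
      (Commute.all (1 - X 1 : MvPolynomial (Fin 2) ℂ) (-X 1)) (n + 1)
    simp only [sub_neg_eq_add, sub_add_cancel, mul_one, Nat.add_sub_cancel] at hs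
    set S : MvPolynomial (Fin 2) ℂ :=
      ∑ i ∈ Finset.range (n + 1), (1 - X 1) ^ i * (-X 1) ^ (n - i) with hS
    refine ⟨(1 - X 0 * X 1) * B + X 0 ^ n * S, ?_, ?_, ?_⟩
    · rw [alpha_succ, hB, show (1 - X 1 : MvPolynomial (Fin 2) ℂ) ^ (n + 1) =
        S + (-X 1) ^ (n + 1) by rw [hs]; ring]
      rw [neg_pow (X 1 : MvPolynomial (Fin 2) ℂ) (n + 1)]
      generalize S = S
      ring
    · have hx : Below (weight (-1) 1) (X 0) (-1) := by
        simpa [weight_apply] using below_X (D := weight (-1) 1) 0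
      have hy : Below (weight (-1) 1) (X 1) 1 := by
        simpa [weight_apply] using below_X (D := weight (-1) 1) 1
      have hSb : Below (weight (-1) 1) S n := by
        refine Below.sum fun i hi => ?_
        have hi' : i ≤ n := Nat.lt_succ_iff.1 (Finset.mem_range.1 hi)
        refine ((((below_one.mono zero_le_one).sub hy).pow i).mul (hy.neg.pow (n - i))).mono ?_
        simp only [nsmul_eq_mul]
        push_cast [hi']
        linarith
      refine Below.add ?_ ?_
      · refine ((below_one.sub ((hx.mul hy).mono (by norm_num))).mul h₁).mono (by norm_num)
      · exact ((hx.pow n).mul hSb).mono (by simp)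
    · have hx : Below (weight 1 0) (X 0) 1 := by
        simpa [weight_apply] using below_X (D := weight 1 0) 0
      have hy : Below (weight 1 0) (X 1) 0 := by
        simpa [weight_apply] using below_X (D := weight 1 0) 1
      have hSb : Below (weight 1 0) S 0 := by
        refine Below.sum fun i hi => ?_
        exact (((below_one.sub hy).pow i).mul (hy.neg.pow (n - i))).mono (by simp)
      refine Below.add ?_ ?_
      · refine (((below_one.mono zero_le_one).sub ((hx.mul hy).mono (by norm_num))).mul h₂).mono
          (by push_cast; linarith)
      · exact ((hx.pow n).mul hSb).mono (by simp)

lemma coeff_X_pow_mul_X_pow (i j : ℕ) (e : Fin 2 →₀ ℕ) :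
    coeff e (X 0 ^ i * X 1 ^ j : MvPolynomial (Fin 2) ℂ) = if expo i j = e then 1 else 0 := by
  have : (X 0 ^ i * X 1 ^ j : MvPolynomial (Fin 2) ℂ) = monomial (expo i j) 1 := by
    rw [X_pow_eq_monomial, X_pow_eq_monomial, monomial_mul, mul_one]
    congr 1
    simp [expo]
  rw [this, coeff_monomial]

lemma alpha_support {n : ℕ} {e : Fin 2 →₀ ℕ}
    (he : coeff e (alpha (X 0) (X 1) n : MvPolynomial (Fin 2) ℂ) ≠ 0) :
    (e 0 < n ∧ e 1 ≤ e 0) ∨ e = expo n (n + 1) := by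
  obtain ⟨B, hB, h₁, h₂⟩ := exists_alpha_eq n
  by_cases h : coeff e B = 0
  · right
    by_contra hne
    refine he ?_
    rw [hB, coeff_add, h]
    rcases neg_one_pow_eq_or (MvPolynomial (Fin 2) ℂ) n with hk | hk <;> rw [hk] <;>
      simp [coeff_X_pow_mul_X_pow, Ne.symm hne]
  · left
    have h₁' := h₁ e h
    have h₂' := h₂ e h
    rw [weight_apply] at h₁' h₂'
    omega

lemma coeff_alpha_self (n : ℕ) :
    coeff (expo n (n + 1)) (alpha (X 0) (X 1) n : MvPolynomial (Fin 2) ℂ) ≠ 0 := by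
  obtain ⟨B, hB, h₁, h₂⟩ := exists_alpha_eq n
  have h : coeff (expo n (n + 1)) B = 0 := by
    by_contra h
    have h₂' := h₂ _ h
    rw [weight_apply, expo_apply_zero] at h₂'
    omega
  rw [hB, coeff_add, h]
  rcases neg_one_pow_eq_or (MvPolynomial (Fin 2) ℂ) n with hk | hk <;> rw [hk] <;>
    simp [coeff_X_pow_mul_X_pow]

lemma coeff_alpha_expo_zero {n i : ℕ} (hi : i < n) :
    coeff (expo i 0) (alpha (X 0) (X 1) n : MvPolynomial (Fin 2) ℂ) = 1 := by
  have h : ∀ n : ℕ, ∃ B : MvPolynomial (Fin 2) ℂ,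
      alpha (X 0) (X 1) n = ∑ k ∈ Finset.range n, X 0 ^ k * X 1 ^ 0 + X 1 * B := by
    intro n
    induction n with
    | zero => exact ⟨1, by simp [alpha]⟩
    | succ n ih =>
      obtain ⟨B, hB⟩ := ih
      obtain ⟨V, hV⟩ : (X 1 : MvPolynomial (Fin 2) ℂ) ∣ (1 - X 1) ^ (n + 1) - 1 := by
        have := sub_dvd_pow_sub_pow (1 - X 1 : MvPolynomial (Fin 2) ℂ) 1 (n + 1)
        rw [one_pow] at this
        exact (Dvd.intro (-1) (by ring)).trans this
      refine ⟨B - X 0 * alpha (X 0) (X 1) n + X 0 ^ n * V, ?_⟩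
      rw [alpha_succ, sub_mul, one_mul, Finset.sum_range_succ, eq_add_of_sub_eq hV]
      conv_lhs => enter [1, 1]; rw [hB]
      ring
  obtain ⟨B, hB⟩ := h n
  rw [hB, coeff_add, coeff_X_mul', if_neg (by simp), coeff_sum, add_zero,
    Finset.sum_eq_single i]
  · rw [coeff_X_pow_mul_X_pow, if_pos rfl]
  · intro k _ hk
    rw [coeff_X_pow_mul_X_pow, if_neg]
    intro h
    exact hk (by simpa using DFunLike.congr_fun h 0)
  · intro h
    exact absurd (Finset.mem_range.2 hi) h

lemma X_dvd_alpha_sub_one (n : ℕ) :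
    (X 0 : MvPolynomial (Fin 2) ℂ) ∣ alpha (X 0) (X 1) (n + 1) - 1 := by
  induction n with
  | zero => exact ⟨(1 - X 1) * X 1 - X 1, by simp only [alpha]; ring⟩
  | succ n ih =>
    obtain ⟨B, hB⟩ := ih
    refine ⟨B - X 1 * alpha (X 0) (X 1) (n + 1) + X 0 ^ n * (1 - X 1) ^ (n + 2), ?_⟩
    rw [alpha_succ]
    linear_combination hB

end Alpha

/-- The polynomials `alpha` in the variables `x` and `y`. -/
noncomputable abbrev polyAlpha (n : ℕ) : MvPolynomial (Fin 2) ℂ := alpha (X 0) (X 1) n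

/-- The signed monomial `(-1) ^ n x ^ r (1 - y) ^ s` with `r = n ^ 2 + 5 n + 5` and
`s = (n + 2) (n + 4)`. -/
noncomputable def signedMon (n : ℕ) : MvPolynomial (Fin 2) ℂ :=
  (-1) ^ n * (X 0 ^ (n ^ 2 + 5 * n + 5) * (1 - X 1) ^ ((n + 2) * (n + 4)))

/-- The product of the negative curve with `x (1 - y) (polyAlpha (n + 3)) ^ (n + 2)`. -/
noncomputable def psi (n : ℕ) : MvPolynomial (Fin 2) ℂ :=
  (polyAlpha (n + 2) ^ (n + 4) - signedMon n) ^ (n + 2) -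
    polyAlpha (n + 2) ^ (n ^ 2 + 5 * n + 5) * polyAlpha (n + 3) ^ (n + 2)

/-- The cofactor `(u ^ (n + 2) - v ^ (n + 2)) / (u - v)` where `u = (polyAlpha (n + 2)) ^ (n + 4)`
and `v = u - signedMon n`. -/
noncomputable def geomCofactor (n : ℕ) : MvPolynomial (Fin 2) ℂ :=
  ∑ k ∈ Finset.range (n + 2), (polyAlpha (n + 2) ^ (n + 4)) ^ k *
    (polyAlpha (n + 2) ^ (n + 4) - signedMon n) ^ (n + 1 - k)

lemma psi_eq (n : ℕ) : psi n = polyAlpha (n + 2) ^ (n ^ 2 + 5 * n + 5) *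
    (polyAlpha (n + 2) ^ (n + 3) - polyAlpha (n + 3) ^ (n + 2)) -
      signedMon n * geomCofactor n := by
  have hs := Commute.geom_sum₂_mul (Commute.all (polyAlpha (n + 2) ^ (n + 4))
    (polyAlpha (n + 2) ^ (n + 4) - signedMon n)) (n + 2)
  rw [show n + 2 - 1 = n + 1 from rfl, sub_sub_cancel] at hs
  rw [mul_comm (signedMon n), geomCofactor, hs, psi]
  ring

lemma one_sub_X_ne_zero : (1 - X 1 : MvPolynomial (Fin 2) ℂ) ≠ 0 := by
  intro h
  have := congrArg (coeff 0) h
  simp at this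

lemma exists_mul_eq_psi (n : ℕ) : ∃ f : MvPolynomial (Fin 2) ℂ,
    f ∈ (Ideal.span {X 0 - 1, X 1 - 1} : Ideal (MvPolynomial (Fin 2) ℂ)) ^
      ((n + 2) * (n ^ 2 + 5 * n + 5) - 1) ∧
    f * (X 0 * (1 - X 1) * polyAlpha (n + 3) ^ (n + 2)) = psi n := by
  set I : Ideal (MvPolynomial (Fin 2) ℂ) := Ideal.span {X 0 - 1, X 1 - 1} with hI
  have hx : X 0 - 1 ∈ I := Ideal.subset_span (by simp)
  have hy : X 1 - 1 ∈ I := Ideal.subset_span (by simp)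
  have hv : 1 - X 1 ∈ I := by
    rw [← neg_sub]
    exact neg_mem hy
  have hw : 1 - X 0 * X 1 ∈ I := by
    rw [show (1 - X 0 * X 1 : MvPolynomial (Fin 2) ℂ) = -(X 1 * (X 0 - 1) + (X 1 - 1)) by ring]
    exact neg_mem (I.add_mem (I.mul_mem_left _ hx) hy)
  obtain ⟨f, hf, hfe⟩ := exists_mem_pow hv hw n
  have hxi := mul_left_cancel₀ (mul_ne_zero (X_ne_zero 0) one_sub_X_ne_zero)
    (mul_xi_mul_alpha (X 0) (X 1 : MvPolynomial (Fin 2) ℂ) n)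
  refine ⟨f, hf, ?_⟩
  rw [← mul_assoc, mul_comm f, hfe, psi, signedMon, ← mul_assoc ((-1) ^ n), polyAlpha, polyAlpha,
    ← hxi]
  ring

section Coefficients

lemma constantCoeff_polyAlpha (n : ℕ) : constantCoeff (polyAlpha (n + 1)) = 1 := by
  have := coeff_alpha_expo_zero n.succ_pos
  rwa [expo_zero] at this

lemma constantCoeff_signedMon (n : ℕ) : constantCoeff (signedMon n) = 0 := by
  simp [signedMon]

lemma constantCoeff_geomCofactor (n : ℕ) : constantCoeff (geomCofactor n) ≠ 0 := by
  simp only [geomCofactor, map_sum, map_mul, map_pow, map_sub, constantCoeff_polyAlpha,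
    constantCoeff_signedMon]
  simp
  norm_cast

lemma X_dvd_polyAlpha_pow_sub_one (n k : ℕ) : X 0 ∣ polyAlpha (n + 1) ^ k - 1 := by
  have := sub_dvd_pow_sub_pow (polyAlpha (n + 1)) 1 k
  rw [one_pow] at this
  exact (X_dvd_alpha_sub_one n).trans this

lemma ne_zero_of_X_dvd {f : MvPolynomial (Fin 2) ℂ} (h : X 0 ∣ f) {e : Fin 2 →₀ ℕ}
    (he : coeff e f ≠ 0) : e 0 ≠ 0 := by
  obtain ⟨g, rfl⟩ := h
  rw [coeff_X_mul'] at he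
  intro h0
  exact he (if_neg (by simpa using h0))

lemma constantCoeff_of_mul_eq_psi {n : ℕ} {f : MvPolynomial (Fin 2) ℂ}
    (hf : f * (X 0 * (1 - X 1) * polyAlpha (n + 3) ^ (n + 2)) = psi n) :
    constantCoeff f ≠ 0 := by
  intro h0
  let φ : MvPolynomial (Fin 2) ℂ →ₐ[ℂ] DualNumber ℂ := aeval ![DualNumber.eps, 0]
  have h2 : (DualNumber.eps : DualNumber ℂ) * DualNumber.eps = 0 := DualNumber.eps_mul_eps
  have h2' (k : ℕ) : (DualNumber.eps : DualNumber ℂ) ^ (k + 2) = 0 := by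
    rw [pow_add, pow_two, h2, mul_zero]
  have hx : φ (X 0) = DualNumber.eps := by simp [φ]
  have hy : φ (X 1) = 0 := by simp [φ]
  have ha (k : ℕ) : φ (polyAlpha (k + 2)) = 1 + DualNumber.eps := by
    have := map_alpha (φ : MvPolynomial (Fin 2) ℂ →+* DualNumber ℂ) (X 0) (X 1) (k + 2)
    simp only [RingHom.coe_coe, hx, hy] at this
    rw [polyAlpha, this]
    clear this
    induction k with
    | zero => simp [alpha]
    | succ k ih => rw [alpha_succ, ih, h2']; simp
  have hf0 : φ f * DualNumber.eps = 0 := by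
    have hfst : (φ f).fst = constantCoeff f := by
      have : (TrivSqZeroExt.fstHom ℂ ℂ ℂ).comp φ = aeval 0 := by
        ext i
        fin_cases i <;> simp [φ]
      have := DFunLike.congr_fun this f
      simpa [aeval_zero] using this
    ext <;> simp [hfst, h0]
  have h := congrArg φ hf
  rw [psi_eq] at h
  simp only [map_mul, map_sub, map_pow, ha, hx, hy, signedMon, map_one, map_neg] at h
  rw [show n ^ 2 + 5 * n + 5 = (n ^ 2 + 5 * n + 3) + 2 by ring, h2', ← mul_assoc, ← mul_assoc,
    hf0] at h
  have h1 (k : ℕ) : (1 + DualNumber.eps : DualNumber ℂ) ^ k * DualNumber.eps = DualNumber.eps := by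
    induction k with
    | zero => simp
    | succ k ih => rw [pow_succ, mul_assoc, add_mul, h2, one_mul, add_zero, ih]
  have : (DualNumber.eps : DualNumber ℂ) = 0 := by
    rw [← h1 (n ^ 2 + 5 * n + 5 + (n + 2))]
    refine Eq.trans ?_ (h.symm.trans ?_)
    · ring
    · ring
  have := congrArg TrivSqZeroExt.snd this
  simp at this

end Coefficients

section Combine

variable {p q r : ℤ} {D : (Fin 2 →₀ ℕ) →+ ℤ ×ₗ ℤ} {f : MvPolynomial (Fin 2) ℂ} {n : ℕ}

lemma lexWeight_eq (p q r : ℤ) (e : Fin 2 →₀ ℕ) :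
    lexWeight p q r e = toLex (p * e 0 + q * e 1, r * e 0) := rfl

lemma below_lexWeight {u s : ℤ} (h : ∀ e, coeff e f ≠ 0 →
    p * e 0 + q * e 1 < u ∨ p * e 0 + q * e 1 = u ∧ r * e 0 ≤ s) :
    Below (lexWeight p q r) f (toLex (u, s)) :=
  fun e he => Prod.Lex.toLex_le_toLex.2 (h e he)

lemma isTop_of_constantCoeff_ne_zero (hf : constantCoeff f ≠ 0) (h : Below D f 0) :
    IsTop D f (expo 0 0) := by
  rw [expo_zero]
  exact ⟨hf, by rwa [map_zero]⟩

lemma below_geomCofactor (ha : Below D (polyAlpha (n + 2)) 0) (hc : Below D (signedMon n) 0) :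
    Below D (geomCofactor n) 0 := by
  have ha' : Below D (polyAlpha (n + 2) ^ (n + 4)) 0 := (ha.pow _).mono (by simp)
  exact Below.sum fun k _ => ((ha'.pow k).mul ((ha'.sub hc).pow _)).mono (by simp)

lemma isTop_signedMon_of_pos (hD : Function.Injective D) (h : 0 < D (Finsupp.single 1 1)) :
    IsTop D (signedMon n) (expo (n ^ 2 + 5 * n + 5) ((n + 2) * (n + 4))) := by
  have := isTop_neg_one_pow_mul ((isTop_X_zero.pow hD (n ^ 2 + 5 * n + 5)).mul hD
    ((isTop_one_sub_X_of_pos h).pow hD ((n + 2) * (n + 4)))) n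
  simpa [signedMon, nsmul_expo, expo_add] using this

lemma isTop_signedMon_of_neg (hD : Function.Injective D) (h : D (Finsupp.single 1 1) < 0) :
    IsTop D (signedMon n) (expo (n ^ 2 + 5 * n + 5) 0) := by
  have := isTop_neg_one_pow_mul ((isTop_X_zero.pow hD (n ^ 2 + 5 * n + 5)).mul hD
    ((isTop_one_sub_X_of_neg h).pow hD ((n + 2) * (n + 4)))) n
  simpa [signedMon, nsmul_expo, expo_add] using this

/-- Divide a leading exponent of `psi n` by that of its known factor. -/
lemma isTop_of_isTop_psi (hD : Function.Injective D)
    (hf : f * (X 0 * (1 - X 1) * polyAlpha (n + 3) ^ (n + 2)) = psi n) {i j s t i' j' : ℕ}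
    (hpsi : IsTop D (psi n) (expo i j)) (hv : IsTop D (1 - X 1) (expo 0 s))
    (hb : IsTop D (polyAlpha (n + 3)) (expo t 0)) (hi : i' + (1 + (n + 2) * t) = i)
    (hj : j' + s = j) : IsTop D f (expo i' j') := by
  obtain ⟨a, ha, hae⟩ := (hf ▸ hpsi).of_mul hD
    (((isTop_X_zero (D := D)).mul hD hv).mul hD (hb.pow hD (n + 2)))
  have h₀ := DFunLike.congr_fun hae 0
  have h₁ := DFunLike.congr_fun hae 1
  simp only [Finsupp.add_apply, Finsupp.smul_apply, expo_apply_zero, expo_apply_one,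
    smul_eq_mul] at h₀ h₁
  rwa [← eq_expo (e := a) (i := i') (j := j') (by omega) (by omega)]

end Combine

variable {n : ℕ} {f : MvPolynomial (Fin 2) ℂ}

lemma isTop_upper_right
    (hf : f * (X 0 * (1 - X 1) * polyAlpha (n + 3) ^ (n + 2)) = psi n) :
    IsTop (lexWeight (-((n + 2) * (n + 4))) (n ^ 2 + 5 * n + 5) 1) f
      (expo (n ^ 3 + 7 * n ^ 2 + 15 * n + 9) (n ^ 3 + 8 * n ^ 2 + 20 * n + 15)) := by
  set D := lexWeight (-((n + 2) * (n + 4))) (n ^ 2 + 5 * n + 5) 1 with hDdef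
  have hD : Function.Injective D := lexWeight_injective (by positivity) one_ne_zero
  have hv : 0 < D (Finsupp.single 1 1) := by
    rw [← map_zero D, hDdef, lexWeight_lt]
    left
    simp
    positivity
  have halpha (k : ℕ) (hk : k = n + 2 ∨ k = n + 3) : Below D (polyAlpha k) 0 := by
    refine below_lexWeight fun e he => ?_
    rcases alpha_support he with ⟨-, h⟩ | rfl
    · rcases Nat.eq_zero_or_pos (e 0) with h0 | h0
      · right
        rw [h0] at h
        simp [h0, Nat.le_zero.1 h]
      · left
        zify at h h0
        nlinarith [mul_le_mul_of_nonneg_left h (show (0 : ℤ) ≤ n ^ 2 + 5 * n + 5 by positivity),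
          mul_pos (show (0 : ℤ) < n + 3 by positivity) h0]
    · left
      rw [expo_apply_zero, expo_apply_one]
      rcases hk with rfl | rfl <;> push_cast <;> nlinarith
  have hc := isTop_signedMon_of_pos (n := n) hD hv
  have hlt : 0 < D (expo (n ^ 2 + 5 * n + 5) ((n + 2) * (n + 4))) := by
    rw [← map_zero D, hDdef, lexWeight_lt]
    right
    simp
    exact ⟨by ring, by positivity⟩
  have ha := halpha _ (Or.inl rfl)
  have hb := halpha _ (Or.inr rfl)
  have h₁ : IsTop D (polyAlpha (n + 2) ^ (n + 4) - signedMon n)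
      (expo (n ^ 2 + 5 * n + 5) ((n + 2) * (n + 4))) := by
    rw [← neg_sub]
    exact (hc.sub_of_lt ((ha.pow (n + 4)).mono (smul_zero _).le) hlt).neg
  have h₂ : IsTop D (psi n) ((n + 2) • expo (n ^ 2 + 5 * n + 5) ((n + 2) * (n + 4))) := by
    refine (h₁.pow hD (n + 2)).sub_of_lt (((ha.pow _).mul (hb.pow _)).mono ?_) (d := 0) ?_
    · simp
    · rw [map_nsmul]
      exact nsmul_pos hlt (by omega)
  rw [nsmul_expo] at h₂
  exact isTop_of_isTop_psi hD hf h₂ (isTop_one_sub_X_of_pos hv)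
    (isTop_of_constantCoeff_ne_zero (by rw [constantCoeff_polyAlpha]; exact one_ne_zero) hb)
    (by ring) (by ring)

lemma isTop_lower_right
    (hf : f * (X 0 * (1 - X 1) * polyAlpha (n + 3) ^ (n + 2)) = psi n) :
    IsTop (lexWeight (n ^ 3 + 8 * n ^ 2 + 20 * n + 15) (-(n + 2) ^ 2) (-1)) f
      (expo (n ^ 3 + 6 * n ^ 2 + 11 * n + 5) 0) := by
  set D := lexWeight (n ^ 3 + 8 * n ^ 2 + 20 * n + 15) (-(n + 2) ^ 2) (-1) with hDdef
  have hD : Function.Injective D := lexWeight_injective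
    (neg_ne_zero.2 (pow_ne_zero _ (by positivity))) (neg_ne_zero.2 one_ne_zero)
  have hv : D (Finsupp.single 1 1) < 0 := by
    rw [← map_zero D, hDdef, lexWeight_lt]
    left
    simp
    positivity
  have ha : Below D (polyAlpha (n + 2)) (D (expo (n + 2) (n + 3))) := by
    intro e he
    rcases alpha_support he with ⟨h₀, -⟩ | rfl
    · rw [hDdef, lexWeight_le]
      left
      rw [expo_apply_zero, expo_apply_one]
      have h₀' : (e 0 : ℤ) ≤ n + 1 := by exact_mod_cast Nat.lt_succ_iff.1 h₀
      push_cast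
      nlinarith [mul_le_mul_of_nonneg_left h₀'
        (show (0 : ℤ) ≤ n ^ 3 + 8 * n ^ 2 + 20 * n + 15 by positivity),
        mul_nonneg (sq_nonneg ((n : ℤ) + 2)) (Int.natCast_nonneg (e 1))]
    · exact le_rfl
  have hb : IsTop D (polyAlpha (n + 3)) (expo (n + 2) 0) := by
    refine ⟨by rw [coeff_alpha_expo_zero (by omega)]; exact one_ne_zero, fun e he => ?_⟩
    rw [hDdef, lexWeight_le, expo_apply_zero, expo_apply_one]
    rcases alpha_support he with ⟨h₀, -⟩ | rfl
    · have h₀' : (e 0 : ℤ) ≤ n + 2 := by exact_mod_cast Nat.lt_succ_iff.1 h₀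
      have h₁ := Int.natCast_nonneg (e 1)
      push_cast
      rcases h₀'.lt_or_eq with h | h
      · left
        nlinarith [mul_pos (sub_pos.2 h)
          (show (0 : ℤ) < n ^ 3 + 8 * n ^ 2 + 20 * n + 15 by positivity),
          mul_nonneg (sq_nonneg ((n : ℤ) + 2)) h₁]
      · rw [h]
        rcases h₁.lt_or_eq with h' | h'
        · left
          nlinarith [mul_pos (show (0 : ℤ) < (n + 2) ^ 2 by positivity) h']
        · right
          simp [← h']
    · left
      rw [expo_apply_zero, expo_apply_one]
      push_cast
      nlinarith
  have hc := isTop_signedMon_of_neg (n := n) hD hv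
  have h₁ : IsTop D (polyAlpha (n + 2) ^ (n + 4) - signedMon n) (expo (n ^ 2 + 5 * n + 5) 0) := by
    rw [← neg_sub]
    refine (hc.sub_of_lt (ha.pow (n + 4)) ?_).neg
    rw [← map_nsmul, nsmul_expo, hDdef, lexWeight_lt]
    left
    simp only [expo_apply_zero, expo_apply_one]
    push_cast
    nlinarith
  have h₂ : IsTop D (psi n) ((n + 2) • expo (n ^ 2 + 5 * n + 5) 0) := by
    refine (h₁.pow hD (n + 2)).sub_of_lt ((ha.pow _).mul (hb.2.pow _)) ?_
    rw [← map_nsmul, ← map_nsmul, ← map_add, nsmul_expo, nsmul_expo, nsmul_expo, expo_add, hDdef,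
      lexWeight_lt]
    right
    simp only [expo_apply_zero, expo_apply_one]
    push_cast
    exact ⟨by ring, by nlinarith⟩
  rw [nsmul_expo] at h₂
  exact isTop_of_isTop_psi hD hf h₂ (isTop_one_sub_X_of_neg hv) hb (by ring) (by ring)

lemma isTop_upper_left
    (hf : f * (X 0 * (1 - X 1) * polyAlpha (n + 3) ^ (n + 2)) = psi n) :
    IsTop (lexWeight (-(n ^ 2 + 5 * n + 5)) ((n + 1) * (n + 3)) 1) f
      (expo (n ^ 2 + 5 * n + 4) (n ^ 2 + 6 * n + 7)) := by
  set D := lexWeight (-(n ^ 2 + 5 * n + 5)) ((n + 1) * (n + 3)) 1 with hDdef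
  have hD : Function.Injective D := lexWeight_injective (by positivity) one_ne_zero
  have hv : 0 < D (Finsupp.single 1 1) := by
    rw [← map_zero D, hDdef, lexWeight_lt]
    left
    simp
    positivity
  set G := weight ((n + 2) * (-(n ^ 2 + 5 * n + 5)) + 1) ((n + 2) * ((n + 1) * (n + 3))) with hG
  have hG0 (k : ℕ) (hk : k = n + 2 ∨ k = n + 3) : Below G (polyAlpha k) 0 := by
    intro e he
    rw [hG, weight_apply]
    rcases alpha_support he with ⟨-, h⟩ | rfl
    · zify at h
      nlinarith [mul_le_mul_of_nonneg_left h
        (show (0 : ℤ) ≤ (n + 2) * ((n + 1) * (n + 3)) by positivity),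
        mul_nonneg (show (0 : ℤ) ≤ (n + 1) * (n + 3) by positivity) (Int.natCast_nonneg (e 0))]
    · rw [expo_apply_zero, expo_apply_one]
      rcases hk with rfl | rfl <;> push_cast <;> nlinarith
  have key {g : MvPolynomial (Fin 2) ℂ} (hg : Below G g 0) {e : Fin 2 →₀ ℕ}
      (he : coeff e g ≠ 0) : (n + 2) * (-(n ^ 2 + 5 * n + 5) * (e 0 : ℤ) +
        (n + 1) * (n + 3) * e 1) + e 0 ≤ 0 := by
    have := hg e he
    rw [hG, weight_apply] at this
    linarith
  have hDG {g : MvPolynomial (Fin 2) ℂ} (hg : Below G g 0) : Below D g 0 := by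
    refine below_lexWeight fun e he => ?_
    have h := key hg he
    have h₀ := Int.natCast_nonneg (e 0)
    rcases lt_trichotomy (-(n ^ 2 + 5 * n + 5) * (e 0 : ℤ) + (n + 1) * (n + 3) * e 1) 0
      with h' | h' | h'
    · exact Or.inl h'
    · rw [h'] at h
      exact Or.inr ⟨h', by linarith⟩
    · nlinarith [mul_pos (show (0 : ℤ) < n + 2 by positivity) h']
  have ha := hDG (hG0 _ (Or.inl rfl))
  have hb := hDG (hG0 _ (Or.inr rfl))
  have hc := isTop_signedMon_of_pos (n := n) hD hv
  have hval : D (expo (n ^ 2 + 5 * n + 5) ((n + 2) * (n + 4))) =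
      toLex (-1, (n : ℤ) ^ 2 + 5 * n + 5) := by
    rw [hDdef, lexWeight_eq, expo_apply_zero, expo_apply_one]
    push_cast
    congr 2 <;> ring
  have hc0 : Below D (signedMon n) 0 :=
    hc.2.mono (by rw [hval]; exact (Prod.Lex.toLex_le_toLex.2 (Or.inl (by norm_num))))
  have hS : IsTop D (geomCofactor n) (expo 0 0) :=
    isTop_of_constantCoeff_ne_zero (constantCoeff_geomCofactor n) (below_geomCofactor ha hc0)
  have hmain : Below D (polyAlpha (n + 2) ^ (n ^ 2 + 5 * n + 5) *
      (polyAlpha (n + 2) ^ (n + 3) - polyAlpha (n + 3) ^ (n + 2))) (toLex (-1, (n : ℤ) + 2)) := by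
    refine below_lexWeight fun e he => ?_
    have h0 : e 0 ≠ 0 := by
      refine ne_zero_of_X_dvd (Dvd.dvd.mul_left ?_ _) he
      rw [← sub_sub_sub_cancel_right _ _ 1]
      exact dvd_sub (X_dvd_polyAlpha_pow_sub_one _ _) (X_dvd_polyAlpha_pow_sub_one _ _)
    have h := key (((((hG0 _ (Or.inl rfl)).pow _).mul ((((hG0 _ (Or.inl rfl)).pow _).mono
      (smul_zero _).le).sub (((hG0 _ (Or.inr rfl)).pow _).mono (smul_zero _).le))).mono
        (by simp))) he
    have h₀ : (0 : ℤ) < e 0 := by exact_mod_cast Nat.pos_of_ne_zero h0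
    have hneg : -(n ^ 2 + 5 * n + 5) * (e 0 : ℤ) + (n + 1) * (n + 3) * e 1 < 0 := by
      by_contra hcon
      nlinarith [mul_nonneg (show (0 : ℤ) ≤ n + 2 by positivity) (not_lt.1 hcon)]
    rcases (Int.le_sub_one_of_lt hneg).lt_or_eq with h' | h'
    · left; linarith
    · right
      rw [h'] at h
      exact ⟨by linarith, by linarith⟩
  have h₂ : IsTop D (psi n) (expo (n ^ 2 + 5 * n + 5) ((n + 2) * (n + 4))) := by
    rw [psi_eq, ← neg_sub]
    have := hc.mul hD hS
    rw [expo_add, add_zero, add_zero] at this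
    refine (this.sub_of_lt hmain ?_).neg
    rw [hval]
    exact Prod.Lex.toLex_lt_toLex.2 (Or.inr ⟨rfl,
      show (n : ℤ) + 2 < n ^ 2 + 5 * n + 5 by nlinarith [Int.natCast_nonneg n]⟩)
  exact isTop_of_isTop_psi hD hf h₂ (isTop_one_sub_X_of_pos hv)
    (isTop_of_constantCoeff_ne_zero (by rw [constantCoeff_polyAlpha]; exact one_ne_zero) hb)
    (by ring) (by ring)

lemma isTop_left
    (hf : f * (X 0 * (1 - X 1) * polyAlpha (n + 3) ^ (n + 2)) = psi n) :
    IsTop (lexWeight (-(n + 2)) (n + 1) 1) f (expo (n + 1) (n + 2)) := by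
  set D := lexWeight (-(n + 2)) (n + 1) 1 with hDdef
  have hD : Function.Injective D := lexWeight_injective (by positivity) one_ne_zero
  have hv : 0 < D (Finsupp.single 1 1) := by
    rw [← map_zero D, hDdef, lexWeight_lt]
    left
    simp
  have hDG {p q : ℕ} (hp : 0 < p) (hq : 0 < q) {g : MvPolynomial (Fin 2) ℂ}
      (hg : ∀ e, coeff e g ≠ 0 → p * (-(n + 2) * (e 0 : ℤ) + (n + 1) * e 1) + q * e 0 ≤ 0) :
      Below D g 0 := by
    refine below_lexWeight fun e he => ?_
    have h := hg e he
    have h₀ := Int.natCast_nonneg (e 0)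
    have hq' : (0 : ℤ) < q := by exact_mod_cast hq
    rcases lt_trichotomy (-(n + 2) * (e 0 : ℤ) + (n + 1) * e 1) 0 with h' | h' | h'
    · exact Or.inl h'
    · rw [h'] at h
      exact Or.inr ⟨h', by nlinarith⟩
    · nlinarith [mul_pos (show (0 : ℤ) < p by exact_mod_cast hp) h', mul_nonneg hq'.le h₀]
  have keya (e) (he : coeff e (polyAlpha (n + 2)) ≠ 0) :
      (n + 2 : ℕ) * (-(n + 2) * (e 0 : ℤ) + (n + 1) * e 1) + (1 : ℕ) * e 0 ≤ 0 := by
    rcases alpha_support he with ⟨-, h⟩ | rfl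
    · zify at h
      push_cast
      nlinarith [mul_le_mul_of_nonneg_left h (show (0 : ℤ) ≤ (n + 2) * (n + 1) by positivity),
        mul_nonneg (show (0 : ℤ) ≤ n + 1 by positivity) (Int.natCast_nonneg (e 0))]
    · rw [expo_apply_zero, expo_apply_one]
      push_cast
      nlinarith
  set G := weight ((n + 3) * (-(n + 2)) + 2) ((n + 3) * (n + 1)) with hG
  have keyb : Below G (polyAlpha (n + 3)) 0 := by
    intro e he
    rw [hG, weight_apply]
    rcases alpha_support he with ⟨-, h⟩ | rfl
    · zify at h
      nlinarith [mul_le_mul_of_nonneg_left h (show (0 : ℤ) ≤ (n + 3) * (n + 1) by positivity),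
        mul_nonneg (show (0 : ℤ) ≤ n + 1 by positivity) (Int.natCast_nonneg (e 0))]
    · rw [expo_apply_zero, expo_apply_one]
      push_cast
      nlinarith
  have ha : Below D (polyAlpha (n + 2)) 0 := hDG (by omega) one_pos keya
  have hb : Below D (polyAlpha (n + 3)) 0 := by
    refine hDG (p := n + 3) (q := 2) (by omega) two_pos fun e he => ?_
    have := keyb e he
    rw [hG, weight_apply] at this
    push_cast
    linarith
  have hc := isTop_signedMon_of_pos (n := n) hD hv
  have hval : D (expo (n ^ 2 + 5 * n + 5) ((n + 2) * (n + 4))) =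
      toLex (-((n : ℤ) + 2), (n : ℤ) ^ 2 + 5 * n + 5) := by
    rw [hDdef, lexWeight_eq, expo_apply_zero, expo_apply_one]
    push_cast
    congr 2 <;> ring
  have hc0 : Below D (signedMon n) 0 := hc.2.mono (by
    rw [hval]
    exact Prod.Lex.toLex_le_toLex.2 (Or.inl (by simp; omega)))
  have hval' : D (expo (n + 2) (n + 3)) = toLex (-1, (n : ℤ) + 2) := by
    rw [hDdef, lexWeight_eq, expo_apply_zero, expo_apply_one]
    push_cast
    congr 2 <;> ring
  have ha1 : IsTop D (polyAlpha (n + 2) - 1) (expo (n + 2) (n + 3)) := by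
    constructor
    · rw [coeff_sub, coeff_one, if_neg, sub_zero]
      · exact coeff_alpha_self _
      · intro h
        simpa using DFunLike.congr_fun h 0
    · rw [hval']
      refine below_lexWeight fun e he => ?_
      have h0 : e 0 ≠ 0 := ne_zero_of_X_dvd (X_dvd_alpha_sub_one _) he
      have h : coeff e (polyAlpha (n + 2)) ≠ 0 := by
        rwa [coeff_sub, coeff_one, if_neg, sub_zero] at he
        rintro rfl
        exact h0 rfl
      have h := keya e h
      push_cast at h
      have h₀ : (0 : ℤ) < e 0 := by exact_mod_cast Nat.pos_of_ne_zero h0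
      have hneg : -(n + 2) * (e 0 : ℤ) + (n + 1) * e 1 < 0 := by
        by_contra hcon
        nlinarith [mul_nonneg (show (0 : ℤ) ≤ n + 2 by positivity) (not_lt.1 hcon)]
      rcases (Int.le_sub_one_of_lt hneg).lt_or_eq with h' | h'
      · left; linarith
      · right
        rw [h'] at h
        exact ⟨by linarith, by linarith⟩
  have hb1 : Below D (polyAlpha (n + 3) ^ (n + 2) - 1) (toLex (-1, (n : ℤ) + 1)) := by
    refine below_lexWeight fun e he => ?_
    have h0 : e 0 ≠ 0 := ne_zero_of_X_dvd (X_dvd_polyAlpha_pow_sub_one _ _) he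
    have h := ((keyb.pow (n + 2)).mono (smul_zero _).le).sub below_one e he
    rw [hG, weight_apply] at h
    have h₀ : (0 : ℤ) < e 0 := by exact_mod_cast Nat.pos_of_ne_zero h0
    have hneg : -(n + 2) * (e 0 : ℤ) + (n + 1) * e 1 < 0 := by
      by_contra hcon
      nlinarith [mul_nonneg (show (0 : ℤ) ≤ n + 3 by positivity) (not_lt.1 hcon)]
    rcases (Int.le_sub_one_of_lt hneg).lt_or_eq with h' | h'
    · left; linarith
    · right
      exact ⟨by linarith, by nlinarith⟩
  have hsum := Commute.geom_sum₂_mul (Commute.all (polyAlpha (n + 2)) 1) (n + 3)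
  simp only [one_pow, mul_one] at hsum
  have hgeom : IsTop D (∑ k ∈ Finset.range (n + 3), polyAlpha (n + 2) ^ k) (expo 0 0) := by
    refine isTop_of_constantCoeff_ne_zero ?_
      (Below.sum fun k _ => (ha.pow k).mono (smul_zero _).le)
    simp only [map_sum, map_pow, constantCoeff_polyAlpha]
    simp
    norm_cast
  have ha0 : IsTop D (polyAlpha (n + 2) ^ (n ^ 2 + 5 * n + 5)) (expo 0 0) :=
    isTop_of_constantCoeff_ne_zero (by simp [constantCoeff_polyAlpha])
      ((ha.pow _).mono (smul_zero _).le)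
  have h₂ : IsTop D (psi n) (expo (n + 2) (n + 3)) := by
    have h := ha0.mul hD (hgeom.mul hD ha1)
    rw [hsum, expo_add, expo_add, zero_add, zero_add, zero_add, zero_add] at h
    have hr : Below D (polyAlpha (n + 2) ^ (n ^ 2 + 5 * n + 5) *
        (polyAlpha (n + 3) ^ (n + 2) - 1) + signedMon n * geomCofactor n)
        (toLex (-1, (n : ℤ) + 1)) := by
      refine Below.add ((ha0.2.mul hb1).mono ?_) ((hc.2.mul (below_geomCofactor ha hc0)).mono ?_)
      · rw [expo_zero, map_zero, zero_add]
      · rw [hval, add_zero]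
        exact Prod.Lex.toLex_le_toLex.2 (Or.inl (by simp; omega))
    have := h.sub_of_lt hr (by
      rw [hval']
      exact Prod.Lex.toLex_lt_toLex.2 (Or.inr ⟨rfl, by simp⟩))
    rw [psi_eq]
    convert this using 1
    ring
  exact isTop_of_isTop_psi hD hf h₂ (isTop_one_sub_X_of_pos hv)
    (isTop_of_constantCoeff_ne_zero (by rw [constantCoeff_polyAlpha]; exact one_ne_zero) hb)
    (by ring) (by ring)

section Irreducible

variable {p q r : ℤ} {f g h : MvPolynomial (Fin 2) ℂ}

lemma IsTop.weight_le {e e' : Fin 2 →₀ ℕ} (hf : IsTop (lexWeight p q r) f e)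
    (he' : coeff e' f ≠ 0) : weight p q e' ≤ weight p q e := by
  rw [weight_apply, weight_apply]
  rcases lexWeight_le.1 (hf.2 e' he') with h | h
  · exact h.le
  · exact h.1.le

lemma weight_le_zero_of_mul (hq : q ≠ 0) {a b : Fin 2 →₀ ℕ} (ha : coeff a g ≠ 0)
    (hb : coeff b h ≠ 0)
    (hgh : ∀ e, coeff e (g * h) ≠ 0 → weight p q e ≤ weight p q a) : weight p q b ≤ 0 := by
  have hD : Function.Injective (lexWeight p q 1) := lexWeight_injective hq one_ne_zero
  obtain ⟨a', ha'⟩ := exists_isTop (lexWeight p q 1) (f := g) (by rintro rfl; simp at ha)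
  obtain ⟨b', hb'⟩ := exists_isTop (lexWeight p q 1) (f := h) (by rintro rfl; simp at hb)
  have h₁ := hgh _ (ha'.mul hD hb').1
  have h₂ := ha'.weight_le ha
  have h₃ := hb'.weight_le hb
  rw [map_add] at h₁
  linarith

lemma exists_eq_add_mul_of_isTop (hq : 0 < q) (hpq : IsCoprime p q)
    {a b : Fin 2 →₀ ℕ} (ha : IsTop (lexWeight p (-q) (-1)) g a)
    (hb : IsTop (lexWeight p (-q) 1) g b) :
    ∃ k : ℤ, 0 ≤ k ∧ (b 0 : ℤ) = a 0 + k * q ∧ (b 1 : ℤ) = a 1 + k * p := by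
  have h₁ := ha.weight_le hb.1
  have h₂ := hb.weight_le ha.1
  have h₃ : (a 0 : ℤ) ≤ b 0 := by
    have := lexWeight_le.1 (ha.2 b hb.1)
    rw [weight_apply, weight_apply] at h₁ h₂
    rcases this with h | h
    · linarith
    · linarith [h.2]
  have heq : p * ((b 0 : ℤ) - a 0) = q * (b 1 - a 1) := by
    rw [weight_apply, weight_apply] at h₁ h₂
    linarith
  obtain ⟨k, hk⟩ : q ∣ (b 0 : ℤ) - a 0 := hpq.symm.dvd_of_dvd_mul_left ⟨_, heq⟩
  refine ⟨k, ?_, by linarith, ?_⟩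
  · by_contra hneg
    nlinarith [mul_pos hq (neg_pos.2 (not_le.1 hneg))]
  · rw [hk] at heq
    have := mul_left_cancel₀ hq.ne' ((mul_left_comm q p k).trans heq)
    linarith

lemma isUnit_of_support (hh : h ≠ 0) (h0 : ∀ b, coeff b h ≠ 0 → b = 0) : IsUnit h := by
  have : h = C (coeff 0 h) := by
    ext b
    rw [coeff_C]
    split_ifs with hb
    · rw [hb]
    · by_contra hne
      exact hb (h0 b hne).symm
  rw [this]
  refine IsUnit.map C (isUnit_iff_ne_zero.2 fun hz => hh ?_)
  rw [this, hz, C_0]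

/-- If the first factor attains the height of the Newton polygon, then the second is constant. -/
lemma isUnit_of_mul {P Q u v : ℤ} {b c : ℕ} (hP : 0 < P) (hQ : 0 < Q) (hu : 0 < u) (hv : 0 < v)
    (hdet : 0 < v * P - u * Q) (hf0 : constantCoeff (g * h) ≠ 0)
    (hhigh : IsTop (lexWeight P (-Q) 1) (g * h) (expo b c))
    (hup : IsTop (lexWeight (-u) v 1) (g * h) (expo b c)) {a : Fin 2 →₀ ℕ}
    (ha : coeff a g ≠ 0) (hac : c ≤ a 1) : IsUnit h := by
  have hD : Function.Injective (lexWeight (-u) v 1) := lexWeight_injective hv.ne' one_ne_zero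
  have hh0 : coeff 0 h ≠ 0 := by
    rw [map_mul] at hf0
    exact right_ne_zero_of_mul hf0
  have hbound {e : Fin 2 →₀ ℕ} (he : coeff e (g * h) ≠ 0) : (e 0 : ℤ) ≤ b ∧ (e 1 : ℤ) ≤ c := by
    have h₁ := hhigh.weight_le he
    have h₂ := hup.weight_le he
    rw [weight_apply, weight_apply, expo_apply_zero, expo_apply_one] at h₁ h₂
    constructor
    · by_contra hcon
      nlinarith [mul_pos hdet (sub_pos.2 (not_le.1 hcon))]
    · by_contra hcon
      nlinarith [mul_pos hdet (sub_pos.2 (not_le.1 hcon))]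
  have hy {e : Fin 2 →₀ ℕ} (he : coeff e h ≠ 0) : e 1 = 0 := by
    have := weight_le_zero_of_mul (p := 0) one_ne_zero ha he fun e' he' => by
      rw [weight_apply, weight_apply]
      zify at hac
      linarith [(hbound he').2]
    rw [weight_apply] at this
    omega
  obtain ⟨t, ht⟩ := exists_isTop (lexWeight (-u) v 1) (f := h) (by rintro rfl; simp at hh0)
  obtain ⟨s, hs, hst⟩ := hup.of_mul hD ht
  have ht0 : t = 0 := by
    have h₁ := ht.weight_le hh0
    rw [map_zero, weight_apply, hy ht.1] at h₁
    have : t 0 = 0 := by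
      by_contra hne
      have : (0 : ℤ) < t 0 := by exact_mod_cast Nat.pos_of_ne_zero hne
      push_cast at h₁
      nlinarith
    rw [eq_expo this (hy ht.1), expo_zero]
  rw [ht0, add_zero] at hst
  rw [hst] at hs
  refine isUnit_of_support ht.ne_zero fun e he => ?_
  have := weight_le_zero_of_mul (p := 1) one_ne_zero hs.1 he fun e' he' => by
    rw [weight_apply, weight_apply, expo_apply_zero, expo_apply_one]
    linarith [(hbound he').1, (hbound he').2]
  rw [weight_apply] at this
  rw [← expo_zero]
  exact eq_expo (by omega) (by omega)

/-- A polynomial with nonzero constant term whose Newton polygon has a lower right vertex `(d, 0)`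
and an upper right vertex `(b, c)` joined by a primitive edge is irreducible. -/
lemma irreducible_of_isTop {P Q u v : ℤ} {b c d : ℕ} (hP : 0 < P) (hQ : 0 < Q) (hPQ : IsCoprime P Q)
    (hu : 0 < u) (hv : 0 < v) (hdet : 0 < v * P - u * Q) (hf0 : constantCoeff f ≠ 0)
    (hlow : IsTop (lexWeight P (-Q) (-1)) f (expo d 0))
    (hup : IsTop (lexWeight (-u) v 1) f (expo b c)) (hc : (c : ℤ) = P) (hb : (b : ℤ) = d + Q)
    (hd : d ≠ 0) : Irreducible f := by
  have hD : Function.Injective (lexWeight P (-Q) (-1)) :=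
    lexWeight_injective (neg_ne_zero.2 hQ.ne') (neg_ne_zero.2 one_ne_zero)
  have hD' : Function.Injective (lexWeight P (-Q) 1) :=
    lexWeight_injective (neg_ne_zero.2 hQ.ne') one_ne_zero
  have hhigh : IsTop (lexWeight P (-Q) 1) f (expo b c) := by
    refine ⟨hup.1, fun e he => ?_⟩
    have h₁ := hlow.weight_le he
    have h₂ := hup.weight_le he
    rw [weight_apply, weight_apply, expo_apply_zero, expo_apply_one] at h₁ h₂
    rw [lexWeight_le, expo_apply_zero, expo_apply_one]
    have hbc : P * b + -Q * c = P * d + -Q * (0 : ℕ) := by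
      rw [hc, hb]
      push_cast
      ring
    rw [← hbc] at h₁
    rcases h₁.lt_or_eq with h | h
    · exact Or.inl h
    · refine Or.inr ⟨h, ?_⟩
      by_contra hcon
      nlinarith [mul_pos hdet (sub_pos.2 (not_le.1 hcon))]
  rw [irreducible_iff]
  constructor
  · intro hunit
    obtain ⟨g, hg⟩ := hunit.exists_right_inv
    obtain ⟨e, he⟩ := exists_isTop (lexWeight P (-Q) (-1)) (f := g) (by rintro rfl; simp at hg)
    have := (hlow.mul hD he).eq hD (hg ▸ isTop_one)
    have := DFunLike.congr_fun this 0
    simp [hd] at this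
  · rintro g h rfl
    obtain ⟨h₂, hh₂⟩ := exists_isTop (lexWeight P (-Q) (-1)) (right_ne_zero_of_mul hlow.ne_zero)
    obtain ⟨h₃, hh₃⟩ := exists_isTop (lexWeight P (-Q) 1) (right_ne_zero_of_mul hlow.ne_zero)
    obtain ⟨g₂, hg₂, h₂sum⟩ := hlow.of_mul hD hh₂
    obtain ⟨g₃, hg₃, h₃sum⟩ := hhigh.of_mul hD' hh₃
    obtain ⟨k, hk, hk₀, hk₁⟩ := exists_eq_add_mul_of_isTop hQ hPQ hg₂ hg₃
    obtain ⟨l, hl, hl₀, hl₁⟩ := exists_eq_add_mul_of_isTop hQ hPQ hh₂ hh₃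
    have e₂ : (g₂ 0 : ℤ) + h₂ 0 = d := by
      have := DFunLike.congr_fun h₂sum 0
      rw [Finsupp.add_apply, expo_apply_zero] at this
      exact_mod_cast this
    have e₃ : (g₃ 0 : ℤ) + h₃ 0 = b := by
      have := DFunLike.congr_fun h₃sum 0
      rw [Finsupp.add_apply, expo_apply_zero] at this
      exact_mod_cast this
    have hkl : k + l = 1 := mul_right_cancel₀ hQ.ne' (by linarith)
    obtain rfl | rfl : k = 1 ∨ l = 1 := by omega
    · right
      exact isUnit_of_mul hP hQ hu hv hdet hf0 hhigh hup hg₃.1 (by omega)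
    · left
      rw [mul_comm g h] at hf0 hhigh hup
      exact isUnit_of_mul hP hQ hu hv hdet hf0 hhigh hup hh₃.1 (by omega)

end Irreducible

section Polygon

/-- Membership in a triangle with a vertex at the origin, by signs of cross products. -/
lemma mem_convexHull_of_cross {s : Set (ℝ × ℝ)} {a b c d i j : ℝ} (h0 : ((0 : ℝ), (0 : ℝ)) ∈ s)
    (ha : (a, b) ∈ s) (hc : (c, d) ∈ s) (hdet : 0 < a * d - b * c) (h₁ : 0 ≤ a * j - b * i)
    (h₂ : 0 ≤ i * d - j * c) (h₃ : (i * d - j * c) + (a * j - b * i) ≤ a * d - b * c) :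
    (i, j) ∈ convexHull ℝ s := by
  have hsub := subset_convexHull ℝ s
  have hconv := convex_convexHull ℝ s
  have key := hconv.sum_mem (t := Finset.univ)
    (w := ![1 - (i * d - j * c) / (a * d - b * c) - (a * j - b * i) / (a * d - b * c),
      (i * d - j * c) / (a * d - b * c), (a * j - b * i) / (a * d - b * c)])
    (z := ![(0, 0), (a, b), (c, d)]) ?_ ?_ ?_
  · have hinv := mul_inv_cancel₀ hdet.ne'
    simp only [div_eq_mul_inv, Fin.sum_univ_three, Matrix.cons_val_zero, Matrix.cons_val_one,
      Matrix.cons_val, Prod.smul_mk, smul_eq_mul, Prod.mk_add_mk] at key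
    convert key using 2
    · linear_combination -i * hinv
    · linear_combination -j * hinv
  · intro k _
    fin_cases k
    · simp only [Fin.zero_eta, Matrix.cons_val_zero]
      rw [sub_sub, ← add_div, sub_nonneg, div_le_one hdet]
      exact h₃
    · exact div_nonneg h₂ hdet.le
    · exact div_nonneg h₁ hdet.le
  · simp only [Fin.sum_univ_three, Matrix.cons_val_zero, Matrix.cons_val_one, Matrix.cons_val]
    ring
  · intro k _
    fin_cases k
    · exact hsub h0
    · exact hsub ha
    · exact hsub hc

/-- The vertices of the pentagon, in terms of `x = K - 4`. -/
def pentagon (x : ℝ) : Set (ℝ × ℝ) :=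
  {(0, 0), (x ^ 3 + 6 * x ^ 2 + 11 * x + 5, 0),
    (x ^ 3 + 7 * x ^ 2 + 15 * x + 9, x ^ 3 + 8 * x ^ 2 + 20 * x + 15),
    (x ^ 2 + 5 * x + 4, x ^ 2 + 6 * x + 7), (x + 1, x + 2)}

lemma mem_convexHull_pentagon {x i j : ℝ} (hx : 0 ≤ x) (hj : 0 ≤ j)
    (h₁ : (x ^ 3 + 8 * x ^ 2 + 20 * x + 15) * i - (x + 2) ^ 2 * j ≤
      (x ^ 3 + 8 * x ^ 2 + 20 * x + 15) * (x ^ 3 + 6 * x ^ 2 + 11 * x + 5))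
    (h₂ : -((x + 2) * (x + 4)) * i + (x ^ 2 + 5 * x + 5) * j ≤
      -((x + 2) * (x + 4)) * (x ^ 3 + 7 * x ^ 2 + 15 * x + 9) +
        (x ^ 2 + 5 * x + 5) * (x ^ 3 + 8 * x ^ 2 + 20 * x + 15))
    (h₃ : -(x ^ 2 + 5 * x + 5) * i + (x + 1) * (x + 3) * j ≤
      -(x ^ 2 + 5 * x + 5) * (x ^ 2 + 5 * x + 4) + (x + 1) * (x + 3) * (x ^ 2 + 6 * x + 7))
    (h₄ : -(x + 2) * i + (x + 1) * j ≤ 0) :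
    (i, j) ∈ convexHull ℝ (pentagon x) := by
  rcases le_total ((x ^ 3 + 7 * x ^ 2 + 15 * x + 9) * j - (x ^ 3 + 8 * x ^ 2 + 20 * x + 15) * i) 0
    with h | h
  · refine mem_convexHull_of_cross (a := x ^ 3 + 6 * x ^ 2 + 11 * x + 5) (b := 0)
      (c := x ^ 3 + 7 * x ^ 2 + 15 * x + 9) (d := x ^ 3 + 8 * x ^ 2 + 20 * x + 15)
      (by simp [pentagon]) (by simp [pentagon]) (by simp [pentagon]) ?_ ?_ ?_ ?_
    · rw [zero_mul, sub_zero]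
      positivity
    · rw [zero_mul, sub_zero]
      positivity
    · linarith
    · linarith
  rcases le_total ((x ^ 2 + 5 * x + 4) * j - (x ^ 2 + 6 * x + 7) * i) 0 with h' | h'
  · refine mem_convexHull_of_cross (a := x ^ 3 + 7 * x ^ 2 + 15 * x + 9)
      (b := x ^ 3 + 8 * x ^ 2 + 20 * x + 15) (c := x ^ 2 + 5 * x + 4) (d := x ^ 2 + 6 * x + 7)
      (by simp [pentagon]) (by simp [pentagon]) (by simp [pentagon]) ?_ h ?_ ?_
    · have : 0 < x ^ 2 + 4 * x + 3 := by positivity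
      linarith
    · linarith
    · linarith [mul_le_mul_of_nonneg_left h₂ (show 0 ≤ x + 1 by positivity)]
  · refine mem_convexHull_of_cross (a := x ^ 2 + 5 * x + 4) (b := x ^ 2 + 6 * x + 7) (c := x + 1)
      (d := x + 2) (by simp [pentagon]) (by simp [pentagon]) (by simp [pentagon]) ?_ h' ?_ ?_
    · linarith
    · linarith
    · linarith

end Polygon

lemma convexHull_support_eq {n : ℕ} {f : MvPolynomial (Fin 2) ℂ}
    (hf : f * (X 0 * (1 - X 1) * polyAlpha (n + 3) ^ (n + 2)) = psi n) :
    convexHull ℝ {p : ℝ × ℝ | ∃ e ∈ f.support, p = ((e 0 : ℝ), (e 1 : ℝ))} =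
      convexHull ℝ (pentagon n) := by
  apply subset_antisymm
  · refine convexHull_min ?_ (convex_convexHull ℝ _)
    rintro _ ⟨e, he, rfl⟩
    rw [mem_support_iff] at he
    have h₁ := (isTop_lower_right hf).weight_le he
    have h₂ := (isTop_upper_right hf).weight_le he
    have h₃ := (isTop_upper_left hf).weight_le he
    have h₄ := (isTop_left hf).weight_le he
    simp only [weight_apply, expo_apply_zero, expo_apply_one] at h₁ h₂ h₃ h₄
    rify at h₁ h₂ h₃ h₄
    apply mem_convexHull_pentagon (Nat.cast_nonneg n) (Nat.cast_nonneg _) <;> linarith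
  · refine convexHull_mono ?_
    have hmem {i j : ℕ} (h : coeff (expo i j) f ≠ 0) :
        ((i : ℝ), (j : ℝ)) ∈ {p : ℝ × ℝ | ∃ e ∈ f.support, p = ((e 0 : ℝ), (e 1 : ℝ))} :=
      ⟨expo i j, mem_support_iff.2 h, by rw [expo_apply_zero, expo_apply_one]⟩
    have h₀ := hmem (i := 0) (j := 0) (by
      rw [expo_zero]
      exact constantCoeff_of_mul_eq_psi hf)
    have h₁ := hmem (isTop_lower_right hf).1
    have h₂ := hmem (isTop_upper_right hf).1
    have h₃ := hmem (isTop_upper_left hf).1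
    have h₄ := hmem (isTop_left hf).1
    push_cast at h₀ h₁ h₂ h₃ h₄
    rintro p (rfl | rfl | rfl | rfl | rfl) <;> assumption

lemma irreducible_of_mul_eq_psi {n : ℕ} {f : MvPolynomial (Fin 2) ℂ}
    (hf : f * (X 0 * (1 - X 1) * polyAlpha (n + 3) ^ (n + 2)) = psi n) : Irreducible f := by
  refine irreducible_of_isTop (P := n ^ 3 + 8 * n ^ 2 + 20 * n + 15) (Q := (n + 2) ^ 2)
    (by positivity) (by positivity) ⟨-1, n + 4, by ring⟩ (by positivity) (by positivity) ?_
    (constantCoeff_of_mul_eq_psi hf) (isTop_lower_right hf) (isTop_upper_right hf)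
    (by push_cast; ring) (by push_cast; ring) (by positivity)
  have : (0 : ℤ) < n ^ 5 + 12 * n ^ 4 + 55 * n ^ 3 + 119 * n ^ 2 + 119 * n + 43 := by positivity
  nlinarith

end NegativeCurve

theorem stmt18 (K N M : ℤ) (hK : 4 ≤ K) (hN : N = K - 2) (hM : M = N ^ 2 - 1)
    (m : ℕ) (hm : (m : ℤ) = N * (M + N) - 1) :
    ∃ f : MvPolynomial (Fin 2) ℂ, Irreducible f ∧
      f ∈ (Ideal.span {X 0 - 1, X 1 - 1} : Ideal (MvPolynomial (Fin 2) ℂ)) ^ m ∧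
      convexHull ℝ {p : ℝ × ℝ | ∃ e ∈ f.support, p = ((e 0 : ℝ), (e 1 : ℝ))} =
        convexHull ℝ
          ({((0 : ℝ), (0 : ℝ)),
            (((M * N - 1 : ℤ) : ℝ), 0),
            (((N * (M + N) - 1 : ℤ) : ℝ), ((K * N ^ 2 - 1 : ℤ) : ℝ)),
            (((M + N - 1 : ℤ) : ℝ), ((K * N - 1 : ℤ) : ℝ)),
            (((N - 1 : ℤ) : ℝ), ((N : ℤ) : ℝ))} : Set (ℝ × ℝ)) := by
  obtain ⟨n, hn⟩ := Int.eq_ofNat_of_zero_le (sub_nonneg.2 hK)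
  obtain rfl : K = n + 4 := by linarith
  obtain rfl : N = n + 2 := by linarith
  subst hM
  obtain ⟨f, hfm, hf⟩ := NegativeCurve.exists_mul_eq_psi n
  refine ⟨f, NegativeCurve.irreducible_of_mul_eq_psi hf, ?_, ?_⟩
  · convert hfm
    zify [Nat.succ_le_of_lt (show 0 < (n + 2) * (n ^ 2 + 5 * n + 5) by positivity)]
    rw [hm]
    ring
  · rw [NegativeCurve.convexHull_support_eq hf, NegativeCurve.pentagon]
    congr 1
    push_cast
    ring_nf
end
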